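/- arXiv:1207.4921 — 2 statements merged into one kernel-verified Lean document; each statement's English description precedes it below -/
import Mathlib

section
/- Let g be an indecomposable symmetrizable Kac-Moody algebra of hyperbolic type, finitely Σ-graded with grading subalgebra m. Then m is also of hyperbolic type. -/
attribute [local instance] Classical.propDecidable

noncomputable section

namespace KMG

open Module

/-! ### Generalized Cartan matrices -/

/-- `A` is a generalized Cartan matrix. -/
def IsGCM {I : Type*} (A : Matrix I I ℤ) : Prop :=
  (∀ i, A i i = 2) ∧ (∀ i j, i ≠ j → A i j ≤ 0) ∧ ∀ i j, A i j = 0 → A j i = 0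

/-- `A` is indecomposable. -/
def Indecomposable {I : Type*} (A : Matrix I I ℤ) : Prop :=
  ∀ s : Set I, s.Nonempty → sᶜ.Nonempty → ∃ i ∈ s, ∃ j ∈ sᶜ, A i j ≠ 0

/-- `A` is symmetrizable: `D A` is symmetric for an invertible diagonal matrix `D`. -/
def Symmetrizable {I : Type*} (A : Matrix I I ℤ) : Prop :=
  ∃ d : I → ℚ, (∀ i, d i ≠ 0) ∧ ∀ i j, d i * (A i j : ℚ) = d j * (A j i : ℚ)

/-- The principal submatrix of `A` indexed by a subset `S`. -/
def restrictM {I : Type*} (A : Matrix I I ℤ) (S : Set I) : Matrix S S ℤ :=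
  fun i j => A i.1 j.1

/-- `A` is of finite type: `A u > 0` for some `u > 0` (Kac, Thm. 4.3). -/
def IsFiniteType {I : Type*} (A : Matrix I I ℤ) : Prop :=
  ∃ u : I → ℚ, (∀ i, 0 < u i) ∧ ∀ i, 0 < ∑ᶠ j, (A i j : ℚ) * u j

/-- `A` is of affine type: `A` indecomposable and `A u = 0` for some `u > 0`. -/
def IsAffineType {I : Type*} (A : Matrix I I ℤ) : Prop :=
  Indecomposable A ∧ ∃ u : I → ℚ, (∀ i, 0 < u i) ∧ ∀ i, ∑ᶠ j, (A i j : ℚ) * u j = 0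

/-- `A` is of indefinite type: `A u < 0` for some `u > 0`. -/
def IsIndefiniteType {I : Type*} (A : Matrix I I ℤ) : Prop :=
  ∃ u : I → ℚ, (∀ i, 0 < u i) ∧ ∀ i, ∑ᶠ j, (A i j : ℚ) * u j < 0

/-- The corank of a generalized Cartan matrix. -/
def gcmCorank {I : Type*} [Fintype I] [DecidableEq I] (A : Matrix I I ℤ) : ℕ :=
  Fintype.card I - (A.map ((↑) : ℤ → ℚ)).rank

/-- The connected component of the vertex `k` in the subdiagram of the Dynkin diagram of `A`
with vertex set `S`. -/
def cmpnt {I : Type*} (A : Matrix I I ℤ) (S : Set I) (k : I) : Set I :=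
  {i | i ∈ S ∧ Relation.ReflTransGen (fun x y => x ∈ S ∧ y ∈ S ∧ A x y ≠ 0) k i}

/-- `A` is hyperbolic: deleting any one vertex of the Dynkin diagram leaves a disjoint union
of diagrams of finite or affine type. -/
def IsHyperbolic {I : Type*} (A : Matrix I I ℤ) : Prop :=
  ∀ i₀ k : I, k ≠ i₀ →
    IsFiniteType (restrictM A (cmpnt A {i | i ≠ i₀} k)) ∨
      IsAffineType (restrictM A (cmpnt A {i | i ≠ i₀} k))

/-- `A` is Lorentzian: `A` is nonsingular and its symmetrization has signature `(+,...,+,-)`. -/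
def IsLorentzian {I : Type*} [Fintype I] [DecidableEq I] (A : Matrix I I ℤ) : Prop :=
  IsUnit (A.map ((↑) : ℤ → ℚ)).det ∧
    ∃ d : I → ℚ, (∀ i, 0 < d i) ∧ (∀ i j, d i * (A i j : ℚ) = d j * (A j i : ℚ)) ∧
      ∃ P : Matrix I I ℝ, IsUnit P.det ∧ ∃ i₀ : I,
        P.transpose * (Matrix.of fun i j => ((d i : ℝ) * (A i j : ℝ))) * P =
          Matrix.diagonal fun i => if i = i₀ then (-1 : ℝ) else 1

/-! ### Weight spaces -/

variable {g : Type*} [LieRing g] [LieAlgebra ℂ g]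

/-- The weight space of weight `χ` for the adjoint action on `g` of a space `V` mapping to `g`
by `ι`. -/
def wtSpaceι {V : Type*} [AddCommGroup V] [Module ℂ V] (ι : V →ₗ[ℂ] g)
    (χ : Module.Dual ℂ V) : Submodule ℂ g where
  carrier := {x | ∀ v : V, ⁅ι v, x⁆ = χ v • x}
  add_mem' := fun ha hb v => by rw [lie_add, ha v, hb v, smul_add]
  zero_mem' := fun v => by rw [lie_zero, smul_zero]
  smul_mem' := fun c x hx v => by rw [lie_smul, hx v, smul_comm]

/-! ### Kac-Moody algebras -/

/-- A (symmetrizable) Kac-Moody algebra structure on the Lie algebra `g`, for the generalized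
Cartan matrix `A` indexed by `I` : a realization `(H, root, coroot)` of `A` together with
Chevalley generators `e i`, `f i` satisfying the Chevalley-Serre relations, such that `g` is
generated by `H` and the `e i, f i`, is diagonalizable under `H`, with `0`-weight space `H`. -/
structure KacMoodyAlgebra {I : Type*} [Fintype I] [DecidableEq I] (A : Matrix I I ℤ)
    (g : Type*) [LieRing g] [LieAlgebra ℂ g] : Type _ where
  H : Submodule ℂ g
  root : I → Module.Dual ℂ H
  coroot : I → H
  e : I → g
  f : I → g
  findimH : FiniteDimensional ℂ H
  finrankH : Module.finrank ℂ H = Fintype.card I + gcmCorank A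
  indepRoot : LinearIndependent ℂ root
  indepCoroot : LinearIndependent ℂ coroot
  pairing : ∀ i j, root j (coroot i) = (A i j : ℂ)
  abelian : ∀ x y : H, ⁅(x : g), (y : g)⁆ = 0
  lie_e : ∀ (x : H) (i : I), ⁅(x : g), e i⁆ = root i x • e i
  lie_f : ∀ (x : H) (i : I), ⁅(x : g), f i⁆ = -(root i x) • f i
  e_f : ∀ i j, ⁅e i, f j⁆ = if j = i then ((coroot i : g)) else 0
  serre_e : ∀ i j, i ≠ j →
    ((LieAlgebra.ad ℂ g (e i)) ^ (1 - A i j).toNat) (e j) = 0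
  serre_f : ∀ i j, i ≠ j →
    ((LieAlgebra.ad ℂ g (f i)) ^ (1 - A i j).toNat) (f j) = 0
  generates : LieSubalgebra.lieSpan ℂ g ((H : Set g) ∪ Set.range e ∪ Set.range f) = ⊤
  weight_decomp : ⨆ χ : Module.Dual ℂ H, wtSpaceι H.subtype χ = ⊤
  zero_weight : wtSpaceι H.subtype (0 : Module.Dual ℂ H) = H

variable {I : Type*} [Fintype I] [DecidableEq I] {A : Matrix I I ℤ}

/-- The root system of a Kac-Moody algebra: nonzero weights of the adjoint action of the
Cartan subalgebra. -/
def Delta (G : KacMoodyAlgebra A g) : Set (Module.Dual ℂ G.H) :=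
  {χ | χ ≠ 0 ∧ wtSpaceι G.H.subtype χ ≠ ⊥}

/-- The positive roots with respect to the standard root basis. -/
def posRoots (G : KacMoodyAlgebra A g) : Set (Module.Dual ℂ G.H) :=
  {χ ∈ Delta G | ∃ c : I → ℕ, χ = ∑ i, (c i : ℂ) • G.root i}

/-- The real roots : the orbit of the simple roots under the Weyl group. -/
inductive IsRealRoot (G : KacMoodyAlgebra A g) : Module.Dual ℂ G.H → Prop
  | simple (i : I) : IsRealRoot G (G.root i)
  | reflect (i : I) (χ : Module.Dual ℂ G.H) :
      IsRealRoot G χ → IsRealRoot G (χ - χ (G.coroot i) • G.root i)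

/-- The subalgebra `g(S)` generated by the root spaces `g_{± α_i}`, `i ∈ S`. -/
def gS (G : KacMoodyAlgebra A g) (S : Set I) : LieSubalgebra ℂ g :=
  LieSubalgebra.lieSpan ℂ g ({x | ∃ i ∈ S, x = G.e i} ∪ {x | ∃ i ∈ S, x = G.f i})

/-- The subspace `h^J = {h ∈ h | ⟨α_j, h⟩ = 0 ∀ j ∈ J}`. -/
def hJsub (G : KacMoodyAlgebra A g) (J : Set I) : Submodule ℂ G.H :=
  ⨅ j ∈ J, LinearMap.ker (G.root j)

/-- `Hk` is the canonical semisimple element attached to `k` and the component `S = I_k` :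
it lies in the span of the coroots from `S` and satisfies `⟨α_i, H_k⟩ = 2 δ_{i,k}` on `S`. -/
def IsHGen (G : KacMoodyAlgebra A g) (S : Set I) (k : I) (Hk : G.H) : Prop :=
  Hk ∈ Submodule.span ℂ (G.coroot '' S) ∧
    ∀ i ∈ S, G.root i Hk = if i = k then 2 else 0

/-- `g(S)` is `A₁`-graded by the `sl₂`-triple with semisimple element `Hk` :
`ad Hk` has only eigenvalues `0, 2, -2` on `g(S)`. -/
def A1GradedBy (G : KacMoodyAlgebra A g) (S : Set I) (Hk : g) : Prop :=
  ∀ x ∈ gS G S, x ∈ Module.End.eigenspace (LieAlgebra.ad ℂ g Hk) 0 ⊔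
    Module.End.eigenspace (LieAlgebra.ad ℂ g Hk) 2 ⊔
      Module.End.eigenspace (LieAlgebra.ad ℂ g Hk) (-2)

/-- The pair `(I_k, J_k)` (for `I_k` the connected component of `k` in `J ∪ {k}`) is an
irreducible `C`-admissible pair. -/
def CAdmissibleComponent (G : KacMoodyAlgebra A g) (J : Set I) (k : I) : Prop :=
  IsFiniteType (restrictM A (cmpnt A (J ∪ {k}) k)) ∧
    ∃ Hk : G.H, IsHGen G (cmpnt A (J ∪ {k}) k) k Hk ∧
      ∃ E F : g, E ∈ gS G (cmpnt A (J ∪ {k}) k) ∧ F ∈ gS G (cmpnt A (J ∪ {k}) k) ∧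
        IsSl2Triple (Hk : g) E F ∧ A1GradedBy G (cmpnt A (J ∪ {k}) k) (Hk : g)

/-- The data of a `C`-admissible pair `(I, J)` : for each `k ∉ J`, the component `I_k` is of
finite type and carries an `sl₂`-triple `(E_k, H_k, F_k)` which `A₁`-grades `g(I_k)`. -/
structure CAdmissibleData (G : KacMoodyAlgebra A g) (J : Set I) : Type _ where
  finJ : IsFiniteType (restrictM A J)
  Hc : {k : I // k ∉ J} → G.H
  E : {k : I // k ∉ J} → g
  F : {k : I // k ∉ J} → g
  finIk : ∀ k : {k : I // k ∉ J}, IsFiniteType (restrictM A (cmpnt A (J ∪ {k.1}) k.1))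
  isHGen : ∀ k, IsHGen G (cmpnt A (J ∪ {k.1}) k.1) k.1 (Hc k)
  memE : ∀ k, E k ∈ gS G (cmpnt A (J ∪ {k.1}) k.1)
  memF : ∀ k, F k ∈ gS G (cmpnt A (J ∪ {k.1}) k.1)
  sl2 : ∀ k, IsSl2Triple ((Hc k : g)) (E k) (F k)
  a1 : ∀ k, A1GradedBy G (cmpnt A (J ∪ {k.1}) k.1) ((Hc k : g))

/-- `(I,J)` is a `C`-admissible pair. -/
def CAdmissiblePair (G : KacMoodyAlgebra A g) (J : Set I) : Prop :=
  Nonempty (CAdmissibleData G J)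

/-- The data of a `C`-admissible pair `(Itot, J)` for a subdiagram `Itot ⊆ I`. -/
structure CAdmissibleDataIn (G : KacMoodyAlgebra A g) (Itot J : Set I) : Type _ where
  subJ : J ⊆ Itot
  finJ : IsFiniteType (restrictM A J)
  Hc : {k : I // k ∈ Itot ∧ k ∉ J} → G.H
  E : {k : I // k ∈ Itot ∧ k ∉ J} → g
  F : {k : I // k ∈ Itot ∧ k ∉ J} → g
  finIk : ∀ k : {k : I // k ∈ Itot ∧ k ∉ J},
    IsFiniteType (restrictM A (cmpnt A (J ∪ {k.1}) k.1))
  isHGen : ∀ k, IsHGen G (cmpnt A (J ∪ {k.1}) k.1) k.1 (Hc k)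
  memE : ∀ k, E k ∈ gS G (cmpnt A (J ∪ {k.1}) k.1)
  memF : ∀ k, F k ∈ gS G (cmpnt A (J ∪ {k.1}) k.1)
  sl2 : ∀ k, IsSl2Triple ((Hc k : g)) (E k) (F k)
  a1 : ∀ k, A1GradedBy G (cmpnt A (J ∪ {k.1}) k.1) ((Hc k : g))

/-- The `C`-admissible subalgebra `g^J` : generated by `h^J` and the `E_k, F_k`. -/
def CAdmissibleData.gJ {G : KacMoodyAlgebra A g} {J : Set I} (D : CAdmissibleData G J) :
    LieSubalgebra ℂ g :=
  LieSubalgebra.lieSpan ℂ g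
    ((((hJsub G J).map G.H.subtype : Submodule ℂ g) : Set g) ∪ Set.range D.E ∪ Set.range D.F)

/-- `GJ` is "the" Kac-Moody structure on `g^J` associated to a `C`-admissible pair: its
Cartan subalgebra is `h^J`, its coroots are the `H_k` and its Chevalley generators are the
`E_k, F_k`; the matrix `A'` is `A^J`, i.e. `a'_{k,l} = ⟨α_l, H_k⟩`. -/
def CAdmissibleData.IsAssocKM {G : KacMoodyAlgebra A g} {J : Set I} (D : CAdmissibleData G J)
    {A' : Matrix {k : I // k ∉ J} {k : I // k ∉ J} ℤ}
    (GJ : KacMoodyAlgebra A' ↥D.gJ) : Prop :=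
  (∀ k l, (A' k l : ℂ) = G.root l.1 (D.Hc k)) ∧
  GJ.H.map D.gJ.toSubmodule.subtype = (hJsub G J).map G.H.subtype ∧
  (∀ k, ((GJ.coroot k : ↥D.gJ) : g) = ((D.Hc k : ↥G.H) : g)) ∧
  (∀ k, ((GJ.e k : ↥D.gJ) : g) = D.E k) ∧ (∀ k, ((GJ.f k : ↥D.gJ) : g) = D.F k)

/-! ### Finite gradations -/

/-- `g` is finitely `Σ`-graded, where `Σ` is the root system of the Kac-Moody algebra `m`
(with Kac-Moody structure `M`) and `m` is embedded in `g` by `φ` (the grading subalgebra is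
the image of `φ`): `g` is the sum of the weight spaces `V_γ`, `γ ∈ Σ ∪ {0}`, of the adjoint
action of the Cartan subalgebra of `m`, and each `V_γ` is finite dimensional. -/
def IsFinGrading {S : Type*} [Fintype S] [DecidableEq S] {B : Matrix S S ℤ}
    {m : Type*} [LieRing m] [LieAlgebra ℂ m] (M : KacMoodyAlgebra B m)
    (φ : m →ₗ⁅ℂ⁆ g) : Prop :=
  Function.Injective φ ∧
  (⨆ χ ∈ insert (0 : Module.Dual ℂ M.H) (Delta M),
      wtSpaceι (φ.toLinearMap ∘ₗ M.H.subtype) χ) = ⊤ ∧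
  ∀ χ ∈ insert (0 : Module.Dual ℂ M.H) (Delta M),
      FiniteDimensional ℂ (wtSpaceι (φ.toLinearMap ∘ₗ M.H.subtype) χ)

section Grading

variable {S : Type*} [Fintype S] [DecidableEq S] {B : Matrix S S ℤ}
variable {m : Type*} [LieRing m] [LieAlgebra ℂ m]

/-- The inclusion of the Cartan subalgebra of the grading subalgebra into the Cartan
subalgebra of `g` (given `a ⊆ h`). -/
def cartanIncl (G : KacMoodyAlgebra A g) (M : KacMoodyAlgebra B m) (φ : m →ₗ⁅ℂ⁆ g)
    (hle : M.H.map φ.toLinearMap ≤ G.H) : M.H →ₗ[ℂ] G.H :=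
  LinearMap.codRestrict G.H (φ.toLinearMap ∘ₗ M.H.subtype)
    (fun x => hle (Submodule.mem_map_of_mem x.2))

/-- The restriction `ρ_a(χ)` to the Cartan subalgebra `a` of `m` of a linear form `χ` on `h`. -/
def resD (G : KacMoodyAlgebra A g) (M : KacMoodyAlgebra B m) (φ : m →ₗ⁅ℂ⁆ g)
    (hle : M.H.map φ.toLinearMap ≤ G.H) (χ : Module.Dual ℂ G.H) : Module.Dual ℂ M.H :=
  χ.comp (cartanIncl G M φ hle)

/-- The restriction `ρ_a(α_i)` of the simple root `α_i` to `a`. -/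
def resRoot (G : KacMoodyAlgebra A g) (M : KacMoodyAlgebra B m) (φ : m →ₗ⁅ℂ⁆ g)
    (hle : M.H.map φ.toLinearMap ≤ G.H) (i : I) : Module.Dual ℂ M.H :=
  resD G M φ hle (G.root i)

/-- The root basis of `M` is adapted to the root basis of `G` :
`ρ_a(Δ⁺) ⊆ Σ⁺ ∪ {0}`. -/
def Adapted (G : KacMoodyAlgebra A g) (M : KacMoodyAlgebra B m) (φ : m →ₗ⁅ℂ⁆ g)
    (hle : M.H.map φ.toLinearMap ≤ G.H) : Prop :=
  ∀ χ ∈ posRoots G, resD G M φ hle χ = 0 ∨ resD G M φ hle χ ∈ posRoots M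

/-- The set `J = {i ∈ I | ρ_a(α_i) = 0}`. -/
def Jof (G : KacMoodyAlgebra A g) (M : KacMoodyAlgebra B m) (φ : m →ₗ⁅ℂ⁆ g)
    (hle : M.H.map φ.toLinearMap ≤ G.H) : Set I :=
  {i | resRoot G M φ hle i = 0}

/-- The set `Γ_s = {i ∈ I' | ρ_a(α_i) = γ_s}`. -/
def GammaOf (G : KacMoodyAlgebra A g) (M : KacMoodyAlgebra B m) (φ : m →ₗ⁅ℂ⁆ g)
    (hle : M.H.map φ.toLinearMap ≤ G.H) (s : S) : Set I :=
  {i | resRoot G M φ hle i = M.root s}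

/-- The set `I'_re = {i ∈ I' | ρ_a(α_i) ∈ Π_a}`. -/
def IpRe (G : KacMoodyAlgebra A g) (M : KacMoodyAlgebra B m) (φ : m →ₗ⁅ℂ⁆ g)
    (hle : M.H.map φ.toLinearMap ≤ G.H) : Set I :=
  {i | ∃ s : S, resRoot G M φ hle i = M.root s}

/-- The set `I'_im = {i ∈ I | ρ_a(α_i) ∉ Π_a ∪ {0}}`. -/
def IpIm (G : KacMoodyAlgebra A g) (M : KacMoodyAlgebra B m) (φ : m →ₗ⁅ℂ⁆ g)
    (hle : M.H.map φ.toLinearMap ≤ G.H) : Set I :=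
  {i | resRoot G M φ hle i ≠ 0 ∧ ∀ s : S, resRoot G M φ hle i ≠ M.root s}

/-- The set `I_re` : union of the components `I_k`, `k ∈ I'_re`. -/
def IreOf (G : KacMoodyAlgebra A g) (M : KacMoodyAlgebra B m) (φ : m →ₗ⁅ℂ⁆ g)
    (hle : M.H.map φ.toLinearMap ≤ G.H) : Set I :=
  {i | ∃ k ∈ IpRe G M φ hle, i ∈ cmpnt A (Jof G M φ hle ∪ {k}) k}

/-- `g` is maximally finitely graded: finitely graded, with `a ⊆ h`, the root basis of the
grading subalgebra adapted, and the corresponding sets `J` and `I'_im` empty. -/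
def MaxFinGrading (G : KacMoodyAlgebra A g) (M : KacMoodyAlgebra B m) (φ : m →ₗ⁅ℂ⁆ g) : Prop :=
  IsFinGrading M φ ∧ ∃ hle : M.H.map φ.toLinearMap ≤ G.H,
    Adapted G M φ hle ∧ Jof G M φ hle = ∅ ∧ IpIm G M φ hle = ∅

end Grading

/-- `(π, πv)` is a root basis (with generalized Cartan matrix `B`) of the root system `Rts`. -/
def IsRootBasis {V : Type*} [AddCommGroup V] [Module ℂ V] {S : Type*} [Fintype S]
    (B : Matrix S S ℤ) (Rts : Set (Module.Dual ℂ V)) (π : S → Module.Dual ℂ V)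
    (πv : S → V) : Prop :=
  LinearIndependent ℂ π ∧ LinearIndependent ℂ πv ∧
  (∀ s t, π t (πv s) = (B s t : ℂ)) ∧ (∀ s, π s ∈ Rts) ∧
  ∀ χ ∈ Rts, (∃ c : S → ℕ, χ = ∑ s, (c s : ℂ) • π s) ∨
    (∃ c : S → ℕ, χ = -∑ s, (c s : ℂ) • π s)

/-- `Bf` is a nondegenerate invariant symmetric bilinear form on `g`. -/
def InvariantForm (Bf : g →ₗ[ℂ] g →ₗ[ℂ] ℂ) : Prop :=
  (∀ x y, Bf x y = Bf y x) ∧ (∀ x y z, Bf ⁅x, y⁆ z = Bf x ⁅y, z⁆) ∧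
  ∀ x, (∀ y, Bf x y = 0) → x = 0

/-- `Bf` is "the" invariant bilinear form of the Kac-Moody algebra `G` : nondegenerate,
invariant, symmetric, with `(α_i∨, α_i∨)` a positive rational for all `i`. -/
def NormalizedInvForm (G : KacMoodyAlgebra A g) (Bf : g →ₗ[ℂ] g →ₗ[ℂ] ℂ) : Prop :=
  InvariantForm Bf ∧ ∀ i : I, ∃ q : ℚ, 0 < q ∧ Bf ((G.coroot i : g)) ((G.coroot i : g)) = (q : ℂ)

/-- `(e', f')` is a system of Chevalley generators for `G` (with the given Cartan subalgebra,
simple roots and coroots). -/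
def IsChevalleyGens (G : KacMoodyAlgebra A g) (e' f' : I → g) : Prop :=
  (∀ (x : G.H) (i : I), ⁅(x : g), e' i⁆ = G.root i x • e' i) ∧
  (∀ (x : G.H) (i : I), ⁅(x : g), f' i⁆ = -(G.root i x) • f' i) ∧
  (∀ i j, ⁅e' i, f' j⁆ = if j = i then ((G.coroot i : g)) else 0) ∧
  (∀ i j, i ≠ j → ((LieAlgebra.ad ℂ g (e' i)) ^ (1 - A i j).toNat) (e' j) = 0) ∧
  (∀ i j, i ≠ j → ((LieAlgebra.ad ℂ g (f' i)) ^ (1 - A i j).toNat) (f' j) = 0) ∧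
  LieSubalgebra.lieSpan ℂ g ((G.H : Set g) ∪ Set.range e' ∪ Set.range f') = ⊤


/-- The subalgebra `g(I_re)` of `g` generated by `h_{I_re}` and the `e_i, f_i`, `i ∈ I_re`. -/
def gIre (G : KacMoodyAlgebra A g) (Ire : Set I) (hIre : Submodule ℂ g) : LieSubalgebra ℂ g :=
  LieSubalgebra.lieSpan ℂ g
    ((hIre : Set g) ∪ {x | ∃ i ∈ Ire, x = G.e i} ∪ {x | ∃ i ∈ Ire, x = G.f i})

/-- `GI` is "the" Kac-Moody structure on `g(I_re)` : its Cartan subalgebra is `h_{I_re}`,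
its coroots and Chevalley generators are the `α_i∨, e_i, f_i` of `g`, for `i ∈ I_re`. -/
def IsAssocKMIre (G : KacMoodyAlgebra A g) (Ire : Set I) (hIre : Submodule ℂ g)
    {A'' : Matrix ↥Ire ↥Ire ℤ} (GI : KacMoodyAlgebra A'' ↥(gIre G Ire hIre)) : Prop :=
  GI.H.map (gIre G Ire hIre).toSubmodule.subtype = hIre ∧
  (∀ i, ((GI.coroot i : ↥(gIre G Ire hIre)) : g) = ((G.coroot i.1 : ↥G.H) : g)) ∧
  (∀ i, ((GI.e i : ↥(gIre G Ire hIre)) : g) = G.e i.1) ∧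
  (∀ i, ((GI.f i : ↥(gIre G Ire hIre)) : g) = G.f i.1)

/-! ### Admissible quotients and maximal gradations -/

/-- `ρ : I → S` is an admissible quotient map for `A` : fibers are totally disconnected (MG1)
and the column sums over a fiber are constant along fibers (MG2). -/
def AdmissibleQuotient {I S : Type*} (A : Matrix I I ℤ) (ρ : I → S) : Prop :=
  Function.Surjective ρ ∧
  (∀ k l, k ≠ l → ρ k = ρ l → A k l = 0) ∧
  ∀ s t : S, s ≠ t → ∀ j j', ρ j = t → ρ j' = t →
    ∑ᶠ i ∈ {i | ρ i = s}, A i j = ∑ᶠ i ∈ {i | ρ i = s}, A i j'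

section Quotient

variable {S : Type*} [Fintype S] [DecidableEq S]

/-- `γ_s∨ = ∑_{k ∈ Γ_s} α_k∨`. -/
def gammaV (G : KacMoodyAlgebra A g) (ρ : I → S) (s : S) : G.H :=
  ∑ᶠ k ∈ {k | ρ k = s}, G.coroot k

/-- `X̄_s = ∑_{k ∈ Γ_s} e_k`. -/
def Xbar (G : KacMoodyAlgebra A g) (ρ : I → S) (s : S) : g :=
  ∑ᶠ k ∈ {k | ρ k = s}, G.e k

/-- `Ȳ_s = ∑_{k ∈ Γ_s} f_k`. -/
def Ybar (G : KacMoodyAlgebra A g) (ρ : I → S) (s : S) : g :=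
  ∑ᶠ k ∈ {k | ρ k = s}, G.f k

/-- The subalgebra `g^ρ` generated by `a` and the `X̄_s, Ȳ_s`. -/
def gRho (G : KacMoodyAlgebra A g) (ρ : I → S) (a : Submodule ℂ G.H) : LieSubalgebra ℂ g :=
  LieSubalgebra.lieSpan ℂ g
    (((a.map G.H.subtype : Submodule ℂ g) : Set g) ∪ Set.range (Xbar G ρ) ∪
      Set.range (Ybar G ρ))

/-- `Gρ` is "the" Kac-Moody structure on `g^ρ` : its Cartan subalgebra is `a`, its coroots
are the `γ_s∨` and its Chevalley generators are the `X̄_s, Ȳ_s`. -/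
def IsAssocKMrho (G : KacMoodyAlgebra A g) (ρ : I → S) (a : Submodule ℂ G.H)
    {Abar : Matrix S S ℤ} (Gρ : KacMoodyAlgebra Abar ↥(gRho G ρ a)) : Prop :=
  Gρ.H.map (gRho G ρ a).toSubmodule.subtype = a.map G.H.subtype ∧
  (∀ s, ((Gρ.coroot s : ↥(gRho G ρ a)) : g) = ((gammaV G ρ s : ↥G.H) : g)) ∧
  (∀ s, ((Gρ.e s : ↥(gRho G ρ a)) : g) = Xbar G ρ s) ∧
  (∀ s, ((Gρ.f s : ↥(gRho G ρ a)) : g) = Ybar G ρ s)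

end Quotient

end KMG


namespace KMG

section QuadraticForms

variable {I : Type*} [Fintype I]

/-- The bilinear form on `ℚ^I` with Gram matrix `M`. -/
def bf (M : I → I → ℚ) : (I → ℚ) →ₗ[ℚ] (I → ℚ) →ₗ[ℚ] ℚ :=
  LinearMap.mk₂ ℚ (fun x y => ∑ i, x i * ∑ j, M i j * y j)
    (fun x x' y => by simp only [Pi.add_apply, add_mul, Finset.sum_add_distrib])
    (fun c x y => by simp only [Pi.smul_apply, smul_eq_mul, mul_assoc, Finset.mul_sum])
    (fun x y y' => by simp only [Pi.add_apply, mul_add, Finset.sum_add_distrib])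
    (fun c x y => by
      simp only [Pi.smul_apply, smul_eq_mul, Finset.mul_sum]
      exact Finset.sum_congr rfl fun i _ => Finset.sum_congr rfl fun j _ => by ring)

lemma bf_apply (M : I → I → ℚ) (x y : I → ℚ) :
    bf M x y = ∑ i, x i * ∑ j, M i j * y j := rfl

lemma bf_symm {M : I → I → ℚ} (hM : ∀ i j, M i j = M j i) (x y : I → ℚ) :
    bf M x y = bf M y x := by
  simp only [bf_apply, Finset.mul_sum]
  rw [Finset.sum_comm]
  exact Finset.sum_congr rfl fun i _ => Finset.sum_congr rfl fun j _ => by rw [hM]; ring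

lemma bf_single_left [DecidableEq I] (M : I → I → ℚ) (i : I) (y : I → ℚ) :
    bf M (Pi.single i 1) y = ∑ j, M i j * y j := by
  simp [bf_apply, Pi.single_apply]

lemma bf_eq_sum_single [DecidableEq I] (M : I → I → ℚ) (x y : I → ℚ) :
    bf M x y = ∑ i, x i * bf M (Pi.single i 1) y := by
  simp only [bf_single_left]; rfl

lemma bf_single_single [DecidableEq I] (M : I → I → ℚ) (i j : I) :
    bf M (Pi.single i 1) (Pi.single j 1) = M i j := by
  simp [bf_single_left, Pi.single_apply]

/-- A symmetric matrix with nonpositive off-diagonal entries is positive semidefinite on a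
set of indices `T` as soon as some vector positive on `T` has nonnegative image there. -/
lemma sum_nonneg_of_pos_vector {J : Type*} {M : J → J → ℚ} (hM : ∀ i j, M i j = M j i)
    (hoff : ∀ i j, i ≠ j → M i j ≤ 0) (T : Finset J) (u : J → ℚ) (hu : ∀ i ∈ T, 0 < u i)
    (hMu : ∀ i ∈ T, 0 ≤ ∑ j ∈ T, M i j * u j) (x : J → ℚ) :
    0 ≤ ∑ i ∈ T, ∑ j ∈ T, M i j * x i * x j := by
  have h1 : 2 * ∑ i ∈ T, ∑ j ∈ T, M i j * x i * x j =
      2 * ∑ i ∈ T, (∑ j ∈ T, M i j * u j) * (x i ^ 2 / u i) -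
        ∑ i ∈ T, ∑ j ∈ T, M i j * (u i * u j) * (x i / u i - x j / u j) ^ 2 := by
    have h2 : ∑ i ∈ T, (∑ j ∈ T, M i j * u j) * (x i ^ 2 / u i) =
        ∑ i ∈ T, ∑ j ∈ T, M i j * u i * (x j ^ 2 / u j) := by
      simp only [Finset.sum_mul]
      rw [Finset.sum_comm]
      exact Finset.sum_congr rfl fun i _ => Finset.sum_congr rfl fun j _ => by rw [hM]
    rw [two_mul (∑ i ∈ T, (∑ j ∈ T, M i j * u j) * (x i ^ 2 / u i))]
    nth_rewrite 1 [h2]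
    simp only [Finset.sum_mul, Finset.mul_sum, ← Finset.sum_add_distrib,
      ← Finset.sum_sub_distrib]
    refine Finset.sum_congr rfl fun i hi => Finset.sum_congr rfl fun j hj => ?_
    have := (hu i hi).ne'
    have := (hu j hj).ne'
    field_simp
    ring
  have h3 : 0 ≤ ∑ i ∈ T, (∑ j ∈ T, M i j * u j) * (x i ^ 2 / u i) :=
    Finset.sum_nonneg fun i hi =>
      mul_nonneg (hMu i hi) (div_nonneg (sq_nonneg _) (hu i hi).le)
  have h4 : ∑ i ∈ T, ∑ j ∈ T, M i j * (u i * u j) * (x i / u i - x j / u j) ^ 2 ≤ 0 := by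
    refine Finset.sum_nonpos fun i hi => Finset.sum_nonpos fun j hj => ?_
    rcases eq_or_ne i j with rfl | hij
    · simp
    · exact mul_nonpos_of_nonpos_of_nonneg (mul_nonpos_of_nonpos_of_nonneg (hoff i j hij)
        (mul_pos (hu i hi) (hu j hj)).le) (sq_nonneg _)
  linarith

lemma finsum_subtype_eq_sum_filter (C : Set I) (f : I → ℚ) :
    ∑ᶠ j : C, f j = ∑ j ∈ Finset.univ.filter (· ∈ C), f j := by
  rw [finsum_set_coe_eq_finsum_mem, ← finsum_mem_coe_finset]
  simp

lemma exists_pos_vector_of_finite_or_affine {A : Matrix I I ℤ} {C : Set I}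
    (h : IsFiniteType (restrictM A C) ∨ IsAffineType (restrictM A C)) :
    ∃ u : I → ℚ, (∀ i ∈ C, 0 < u i) ∧
      ∀ i ∈ C, 0 ≤ ∑ j ∈ Finset.univ.filter (· ∈ C), (A i j : ℚ) * u j := by
  have key : ∃ u : C → ℚ, (∀ i, 0 < u i) ∧
      ∀ i, 0 ≤ ∑ᶠ j, (restrictM A C i j : ℚ) * u j := by
    rcases h with ⟨u, hu, h⟩ | ⟨-, u, hu, h⟩
    · exact ⟨u, hu, fun i => (h i).le⟩
    · exact ⟨u, hu, fun i => (h i).ge⟩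
  obtain ⟨u, hu, h⟩ := key
  refine ⟨fun i => if hi : i ∈ C then u ⟨i, hi⟩ else 0, fun i hi => by simp [hi, hu],
    fun i hi => ?_⟩
  rw [← finsum_subtype_eq_sum_filter C
    (fun j => (A i j : ℚ) * if hi : j ∈ C then u ⟨j, hi⟩ else 0)]
  convert h ⟨i, hi⟩ using 3 with j
  simp [restrictM]

lemma cmpnt_symm {J : Type*} {A : Matrix J J ℤ} (hA : IsGCM A) {T : Set J} {k k' : J}
    (hk : k ∈ T) (h : k' ∈ cmpnt A T k) : k ∈ cmpnt A T k' := by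
  refine ⟨hk, ?_⟩
  have : Std.Symm fun x y => x ∈ T ∧ y ∈ T ∧ A x y ≠ 0 :=
    ⟨fun x y ⟨hx, hy, hxy⟩ => ⟨hy, hx, fun h0 => hxy (hA.2.2 _ _ h0)⟩⟩
  exact (Relation.ReflTransGen.stdSymm (r := fun x y => x ∈ T ∧ y ∈ T ∧ A x y ≠ 0)).symm _ _ h.2

lemma cmpnt_subset {J : Type*} {A : Matrix J J ℤ} {T : Set J} {k k' : J} (h : k' ∈ cmpnt A T k) :
    cmpnt A T k' ⊆ cmpnt A T k :=
  fun _ hx => ⟨hx.1, h.2.trans hx.2⟩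

lemma cmpnt_eq {J : Type*} {A : Matrix J J ℤ} (hA : IsGCM A) {T : Set J} {k k' : J}
    (hk : k ∈ T) (h : k' ∈ cmpnt A T k) : cmpnt A T k' = cmpnt A T k :=
  (cmpnt_subset h).antisymm (cmpnt_subset (cmpnt_symm hA hk h))

/-- The form attached to a hyperbolic matrix is nonnegative on vectors with a zero
coordinate. -/
lemma bf_nonneg_of_hyperbolic {A : Matrix I I ℤ} (hA : IsGCM A) (hhyp : IsHyperbolic A)
    {d : I → ℚ} (hd : ∀ i, 0 < d i) (hsym : ∀ i j, d i * (A i j : ℚ) = d j * (A j i : ℚ))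
    (x : I → ℚ) (i₀ : I) (hx : x i₀ = 0) :
    0 ≤ bf (fun i j => d i * (A i j : ℚ)) x x := by
  set T : Set I := {i | i ≠ i₀} with hT
  have hcomp : ∀ C : Set I, (∃ k ∈ T, C = cmpnt A T k) → ∃ u : I → ℚ, (∀ i ∈ C, 0 < u i) ∧
      ∀ i ∈ C, 0 ≤ ∑ j ∈ Finset.univ.filter (· ∈ C), (A i j : ℚ) * u j := by
    rintro C ⟨k, hk, rfl⟩
    exact exists_pos_vector_of_finite_or_affine (hhyp i₀ k hk)
  choose! u hu hAu using hcomp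
  have hmem : ∀ i ∈ T, i ∈ cmpnt A T i := fun i hi => ⟨hi, .refl⟩
  have key := sum_nonneg_of_pos_vector (M := fun i j => d i * (A i j : ℚ)) hsym
    (fun i j hij => mul_nonpos_of_nonneg_of_nonpos (hd i).le
      (by exact_mod_cast hA.2.1 i j hij)) (Finset.univ.filter (· ∈ T))
    (fun i => u (cmpnt A T i) i) ?_ ?_ x
  · have h1 : ∀ f : I → ℚ, (f i₀ = 0) → ∑ i ∈ Finset.univ.filter (· ∈ T), f i = ∑ i, f i := by
      intro f hf
      refine Finset.sum_subset (Finset.subset_univ _) fun i _ hi => ?_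
      have : i = i₀ := by simpa [hT] using hi
      rw [this, hf]
    rw [h1 _ (by simp [hx])] at key
    refine key.trans_eq ?_
    rw [bf_apply]
    refine Finset.sum_congr rfl fun i _ => ?_
    rw [h1 _ (by simp [hx]), Finset.mul_sum]
    exact Finset.sum_congr rfl fun j _ => by ring
  · intro i hi
    have hi : i ∈ T := by simpa using hi
    exact hu _ ⟨i, hi, rfl⟩ i (hmem i hi)
  · intro i hi
    have hi : i ∈ T := by simpa using hi
    have h2 := hAu _ ⟨i, hi, rfl⟩ i (hmem i hi)
    have h3 : ∑ j ∈ Finset.univ.filter (· ∈ T), (A i j : ℚ) * u (cmpnt A T j) j =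
        ∑ j ∈ Finset.univ.filter (· ∈ cmpnt A T i), (A i j : ℚ) * u (cmpnt A T i) j := by
      symm
      refine (Finset.sum_congr rfl fun j hj => ?_).trans (Finset.sum_subset ?_ ?_)
      · rw [cmpnt_eq hA hi (show j ∈ cmpnt A T i by simpa using hj)]
      · intro j hj
        have : j ∈ cmpnt A T i := by simpa using hj
        simpa using this.1
      · intro j hj hj'
        have hj : j ∈ T := by simpa using hj
        have hj' : j ∉ cmpnt A T i := by simpa using hj'
        have : A i j = 0 := by
          by_contra h0
          exact hj' ⟨hj, .single ⟨hi, hj, h0⟩⟩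
        simp [this]
    simp only [mul_assoc, ← Finset.mul_sum, h3]
    exact mul_nonneg (hd i).le h2

end QuadraticForms

section FiniteAffine

variable {I : Type*}

lemma exists_pos_symmetrizer {A : Matrix I I ℤ} (hA : IsGCM A) (hInd : Indecomposable A)
    (hSym : Symmetrizable A) :
    ∃ d : I → ℚ, (∀ i, 0 < d i) ∧ ∀ i j, d i * (A i j : ℚ) = d j * (A j i : ℚ) := by
  obtain ⟨d, hd0, hd⟩ := hSym
  by_cases h1 : {i | 0 < d i}.Nonempty
  · by_cases h2 : {i | 0 < d i}ᶜ.Nonempty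
    · obtain ⟨i, hi, j, hj, hij⟩ := hInd _ h1 h2
      have hi : 0 < d i := hi
      have hj : d j < 0 := lt_of_le_of_ne (not_lt.mp hj) (hd0 j)
      have hne : i ≠ j := by rintro rfl; exact lt_asymm hi hj
      have h3 : (A i j : ℚ) < 0 := by
        exact_mod_cast lt_of_le_of_ne (hA.2.1 i j hne) hij
      have h4 : (A j i : ℚ) ≤ 0 := by exact_mod_cast hA.2.1 j i hne.symm
      nlinarith [hd i j]
    · refine ⟨d, fun i => ?_, hd⟩
      by_contra h
      exact h2 ⟨i, h⟩
  · refine ⟨-d, fun i => ?_, fun i j => by simp [hd i j]⟩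
    have : ¬ 0 < d i := fun h => h1 ⟨i, h⟩
    simpa using lt_of_le_of_ne (not_lt.mp this) (hd0 i)

lemma indecomposable_restrictM_cmpnt {A : Matrix I I ℤ} (hA : IsGCM A) (T : Set I) (k : I) :
    Indecomposable (restrictM A (cmpnt A T k)) := by
  intro s hs hs'
  by_contra! h
  have hstep : ∀ a b : cmpnt A T k, A a b ≠ 0 → (a ∈ s ↔ b ∈ s) := by
    intro a b hab
    constructor
    · intro ha
      by_contra hb
      exact hab (h a ha b hb)
    · intro hb
      by_contra ha
      exact hab (hA.2.2 _ _ (h b hb a ha))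
  have hkT : k ∈ T := by
    obtain ⟨x, -⟩ := hs
    rcases Relation.ReflTransGen.cases_head x.2.2 with h1 | ⟨c, h1, -⟩
    · rw [h1]; exact x.2.1
    · exact h1.1
  have hk : k ∈ cmpnt A T k := ⟨hkT, .refl⟩
  have hall : ∀ x (hx : x ∈ cmpnt A T k), (⟨k, hk⟩ ∈ s ↔ ⟨x, hx⟩ ∈ s) := by
    rintro x ⟨hxT, hx⟩
    induction hx with
    | refl => rfl
    | tail hab hbc ih =>
      exact (ih hbc.1).trans (hstep ⟨_, hbc.1, hab⟩ ⟨_, hxT, hab.tail hbc⟩ hbc.2.2)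
  obtain ⟨a, ha⟩ := hs
  obtain ⟨b, hb⟩ := hs'
  exact hb ((hall b b.2).mp ((hall a a.2).mpr ha))

lemma isGCM_restrictM {A : Matrix I I ℤ} (hA : IsGCM A) (T : Set I) :
    IsGCM (restrictM A T) :=
  ⟨fun i => hA.1 i, fun i j hij => hA.2.1 i j fun h => hij (Subtype.ext h),
    fun i j => hA.2.2 i j⟩

variable [Fintype I]

lemma bf_add_self {M : I → I → ℚ} (hM : ∀ i j, M i j = M j i) (x y : I → ℚ) :
    bf M (x + y) (x + y) = bf M x x + 2 * bf M x y + bf M y y := by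
  simp only [map_add, LinearMap.add_apply, bf_symm hM y x]
  ring

lemma bf_add_smul_self {M : I → I → ℚ} (hM : ∀ i j, M i j = M j i) (x y : I → ℚ) (t : ℚ) :
    bf M (x + t • y) (x + t • y) = bf M x x + 2 * t * bf M x y + t ^ 2 * bf M y y := by
  rw [bf_add_self hM]
  simp only [map_smul, LinearMap.smul_apply, smul_eq_mul]
  ring

lemma bf_smul_self (M : I → I → ℚ) (x : I → ℚ) (t : ℚ) :
    bf M (t • x) (t • x) = t ^ 2 * bf M x x := by
  simp only [map_smul, LinearMap.smul_apply, smul_eq_mul]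
  ring

/-- The form is nonpositive on a pair of nonnegative vectors with disjoint supports. -/
lemma bf_nonpos_of_disjoint {M : I → I → ℚ} (hoff : ∀ i j, i ≠ j → M i j ≤ 0) {x y : I → ℚ}
    (hx : ∀ i, 0 ≤ x i) (hy : ∀ i, 0 ≤ y i) (hxy : ∀ i, x i = 0 ∨ y i = 0) :
    bf M x y ≤ 0 := by
  simp only [bf_apply, Finset.mul_sum]
  refine Finset.sum_nonpos fun i _ => Finset.sum_nonpos fun j _ => ?_
  rcases eq_or_ne i j with rfl | hij
  · rcases hxy i with h | h <;> simp [h]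
  · exact mul_nonpos_of_nonneg_of_nonpos (hx i)
      (mul_nonpos_of_nonpos_of_nonneg (hoff i j hij) (hy j))

lemma max_sub_max_neg {J : Type*} (x : J → ℚ) :
    x = (fun i => max (x i) 0) + (-1 : ℚ) • fun i => max (-x i) 0 := by
  ext i
  simp only [Pi.add_apply, Pi.smul_apply, smul_eq_mul]
  rcases le_total 0 (x i) with h | h
  · rw [max_eq_left h, max_eq_right (by linarith)]; ring
  · rw [max_eq_right h, max_eq_left (by linarith)]; ring

lemma bf_max_nonpos {M : I → I → ℚ} (hoff : ∀ i j, i ≠ j → M i j ≤ 0) (x : I → ℚ) :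
    bf M (fun i => max (x i) 0) (fun i => max (-x i) 0) ≤ 0 := by
  refine bf_nonpos_of_disjoint hoff (fun i => le_max_right _ _) (fun i => le_max_right _ _)
    fun i => ?_
  rcases le_total 0 (x i) with h | h
  · right; simpa using h
  · left; simpa using h

/-- If the form is nonnegative on vectors with a zero coordinate, then every vector of
negative norm has all its coordinates of the same strict sign. -/
lemma sign_of_bf_neg {M : I → I → ℚ} (hM : ∀ i j, M i j = M j i)
    (hoff : ∀ i j, i ≠ j → M i j ≤ 0)
    (hprop : ∀ x : I → ℚ, ∀ i₀, x i₀ = 0 → 0 ≤ bf M x x) {v : I → ℚ} (hv : bf M v v < 0) :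
    (∀ i, 0 < v i) ∨ ∀ i, v i < 0 := by
  have h0 : ∀ i, v i ≠ 0 := fun i hi => (hprop v i hi).not_gt hv
  by_contra! h
  obtain ⟨⟨i, hi⟩, j, hj⟩ := h
  have h1 := hprop (fun i => max (v i) 0) i (max_eq_right hi)
  have h2 := hprop (fun i => max (-v i) 0) j (max_eq_right (by linarith))
  rw [max_sub_max_neg v, bf_add_smul_self hM] at hv
  linarith [bf_max_nonpos hoff v]

lemma bf_eq_zero_of_null {M : I → I → ℚ} (hM : ∀ i j, M i j = M j i)
    (hpsd : ∀ x, 0 ≤ bf M x x) {z : I → ℚ} (hz : bf M z z = 0) (w : I → ℚ) :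
    bf M z w = 0 := by
  by_contra hb
  have h1 := hpsd w
  have h2 := hpsd (z + (-(bf M z w) / (bf M w w + 1)) • w)
  rw [bf_add_smul_self hM, hz] at h2
  have h3 : 0 < bf M w w + 1 := by linarith
  have h4 : 0 < bf M z w ^ 2 := by positivity
  have : 0 + 2 * (-(bf M z w) / (bf M w w + 1)) * bf M z w +
      (-(bf M z w) / (bf M w w + 1)) ^ 2 * bf M w w =
      -(bf M z w ^ 2) * (bf M w w + 2) / (bf M w w + 1) ^ 2 := by
    field_simp
    ring
  rw [this] at h2
  have : -(bf M z w ^ 2) * (bf M w w + 2) / (bf M w w + 1) ^ 2 < 0 :=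
    div_neg_of_neg_of_pos (by nlinarith) (by positivity)
  linarith

/-- An indecomposable generalized Cartan matrix with positive semidefinite symmetrization is
of finite or affine type. -/
lemma finite_or_affine_of_psd {C : Matrix I I ℤ} (hC : IsGCM C) (hInd : Indecomposable C)
    {d : I → ℚ} (hd : ∀ i, 0 < d i) (hsym : ∀ i j, d i * (C i j : ℚ) = d j * (C j i : ℚ))
    (hpsd : ∀ x, 0 ≤ bf (fun i j => d i * (C i j : ℚ)) x x) :
    IsFiniteType C ∨ IsAffineType C := by
  classical
  set M : I → I → ℚ := fun i j => d i * (C i j : ℚ) with hMdef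
  have hoff : ∀ i j, i ≠ j → M i j ≤ 0 := fun i j hij =>
    mul_nonpos_of_nonneg_of_nonpos (hd i).le (by exact_mod_cast hC.2.1 i j hij)
  have hrow : ∀ i (y : I → ℚ), bf M (Pi.single i 1) y = d i * ∑ j, (C i j : ℚ) * y j := by
    intro i y
    rw [bf_single_left, Finset.mul_sum]
    exact Finset.sum_congr rfl fun j _ => by simp only [hMdef]; ring
  have hneg : ∀ (y : I → ℚ) i, (∀ j, 0 ≤ y j) → y i = 0 → ∀ j ∈ Finset.univ,
      (C i j : ℚ) * y j ≤ 0 := by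
    intro y i hy hi j _
    rcases eq_or_ne i j with rfl | hij
    · simp [hi]
    · exact mul_nonpos_of_nonpos_of_nonneg (by exact_mod_cast hC.2.1 i j hij) (hy j)
  by_cases hdef : ∀ x, bf M x x = 0 → x = 0
  · left
    let L : (I → ℚ) →ₗ[ℚ] (I → ℚ) := Matrix.mulVecLin (Matrix.of fun i j => (C i j : ℚ))
    have hL : ∀ x i, L x i = ∑ j, (C i j : ℚ) * x j := fun x i => rfl
    have hinj : Function.Injective L := by
      rw [← LinearMap.ker_eq_bot, LinearMap.ker_eq_bot']
      intro x hx
      apply hdef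
      rw [bf_eq_sum_single]
      refine Finset.sum_eq_zero fun i _ => ?_
      rw [hrow, ← hL, hx]
      simp
    obtain ⟨y, hy⟩ := LinearMap.injective_iff_surjective.mp hinj (fun _ => 1)
    have hy1 : ∀ i, ∑ j, (C i j : ℚ) * y j = 1 := fun i => by rw [← hL, hy]
    have hminus : (fun i => max (-y i) 0) = 0 := by
      apply hdef
      refine le_antisymm ?_ (hpsd _)
      have h1 : 0 ≤ bf M (fun i => max (-y i) 0) y := by
        rw [bf_eq_sum_single]
        refine Finset.sum_nonneg fun i _ => mul_nonneg (le_max_right _ _) ?_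
        rw [hrow, hy1]
        simpa using (hd i).le
      have h2 := bf_max_nonpos hoff y
      rw [bf_symm hsym] at h2
      nth_rewrite 2 [max_sub_max_neg y] at h1
      rw [map_add, map_smul] at h1
      simp only [smul_eq_mul] at h1
      linarith
    have hy0 : ∀ i, 0 ≤ y i := by
      intro i
      have := congrFun hminus i
      simpa using this
    refine ⟨y, fun i => lt_of_le_of_ne (hy0 i) fun h => ?_, fun i => ?_⟩
    · have := Finset.sum_nonpos (hneg y i hy0 h.symm)
      rw [hy1] at this
      linarith
    · rw [finsum_eq_sum_of_fintype, hy1]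
      exact one_pos
  · right
    push Not at hdef
    obtain ⟨x, hx, hx0⟩ := hdef
    refine ⟨hInd, fun i => |x i|, ?_⟩
    have hz : bf M (fun i => |x i|) (fun i => |x i|) = 0 := by
      refine le_antisymm ?_ (hpsd _)
      rw [← hx]
      simp only [bf_apply, Finset.mul_sum]
      refine Finset.sum_le_sum fun i _ => Finset.sum_le_sum fun j _ => ?_
      rcases eq_or_ne i j with rfl | hij
      · have := abs_mul_abs_self (x i)
        exact le_of_eq (by linear_combination M i i * this)
      · have := hoff i j hij
        have h2 : x i * x j ≤ |x i| * |x j| := by rw [← abs_mul]; exact le_abs_self _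
        nlinarith
    have hz0 : ∀ i, ∑ j, (C i j : ℚ) * |x j| = 0 := by
      intro i
      have h1 := bf_eq_zero_of_null hsym hpsd hz (Pi.single i 1)
      rw [bf_symm hsym, hrow] at h1
      exact (mul_eq_zero.mp h1).resolve_left (hd i).ne'
    refine ⟨fun i => abs_pos.mpr ?_, fun i => by rw [finsum_eq_sum_of_fintype, hz0]⟩
    by_contra hi
    obtain ⟨j, hj⟩ := Function.ne_iff.mp hx0
    obtain ⟨a, ha, b, hb, hab⟩ := hInd {i | x i = 0} ⟨i, hi⟩ ⟨j, hj⟩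
    have ha : x a = 0 := ha
    have h1 := (Finset.sum_eq_zero_iff_of_nonpos
      (hneg (fun i => |x i|) a (fun _ => abs_nonneg _) (by simp [ha]))).mp (hz0 a) b
      (Finset.mem_univ _)
    rcases mul_eq_zero.mp h1 with h2 | h2
    · exact hab (by exact_mod_cast h2)
    · exact hb (abs_eq_zero.mp h2)

end FiniteAffine

section WeightSpaces

variable {g : Type*} [LieRing g] [LieAlgebra ℂ g]
variable {V : Type*} [AddCommGroup V] [Module ℂ V]

lemma lie_mem_wtSpaceι {ι : V →ₗ[ℂ] g} {χ ψ : Module.Dual ℂ V} {x y : g}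
    (hx : x ∈ wtSpaceι ι χ) (hy : y ∈ wtSpaceι ι ψ) : ⁅x, y⁆ ∈ wtSpaceι ι (χ + ψ) := by
  intro v
  rw [leibniz_lie, hx v, hy v, smul_lie, lie_smul, LinearMap.add_apply, add_smul]

lemma iSupIndep_wtSpaceι {ι : V →ₗ[ℂ] g} (hι : ∀ v w, ⁅ι v, ι w⁆ = 0) :
    iSupIndep (wtSpaceι ι) := by
  have h1 := Module.End.independent_iInf_maxGenEigenspace_of_forall_mapsTo
    (fun v : V => LieAlgebra.ad ℂ g (ι v)) (fun i j μ => by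
      refine Module.End.mapsTo_maxGenEigenspace_of_comm ?_ μ
      refine LinearMap.ext fun x => ?_
      change ⁅ι j, ⁅ι i, x⁆⁆ = ⁅ι i, ⁅ι j, x⁆⁆
      rw [leibniz_lie, hι, zero_lie, zero_add])
  have h2 := h1.comp (f := fun χ : Module.Dual ℂ V => (χ : V → ℂ)) DFunLike.coe_injective
  refine h2.mono fun χ x hx => ?_
  simp only [Function.comp_apply, Submodule.mem_iInf]
  intro v
  refine Module.End.mem_maxGenEigenspace _ _ _ |>.mpr ⟨1, ?_⟩
  simp [hx v]

end WeightSpaces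

section KacMoody

variable {I : Type*} [Fintype I] [DecidableEq I] {A : Matrix I I ℤ}
variable {g : Type*} [LieRing g] [LieAlgebra ℂ g]

namespace KacMoodyAlgebra

variable (G : KacMoodyAlgebra A g)

/-- The weight spaces of the Cartan subalgebra. -/
abbrev wtSp (χ : Module.Dual ℂ G.H) : Submodule ℂ g := wtSpaceι G.H.subtype χ

/-- The element of the root lattice with given integral coordinates. -/
def wt : (I → ℤ) →+ Module.Dual ℂ G.H where
  toFun v := ∑ i, (v i : ℂ) • G.root i
  map_zero' := by simp
  map_add' v w := by simp [add_smul, Finset.sum_add_distrib]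

lemma wt_apply (v : I → ℤ) : G.wt v = ∑ i, (v i : ℂ) • G.root i := rfl

lemma wt_single (i : I) : G.wt (Pi.single i 1) = G.root i := by
  simp [wt_apply, Pi.single_apply]

lemma wt_injective : Function.Injective G.wt := by
  rw [injective_iff_map_eq_zero]
  intro v hv
  ext i
  exact_mod_cast Fintype.linearIndependent_iff.mp G.indepRoot _ hv i

lemma mem_wtSp {χ : Module.Dual ℂ G.H} {x : g} :
    x ∈ G.wtSp χ ↔ ∀ h : G.H, ⁅(h : g), x⁆ = χ h • x := Iff.rfl

lemma iSupIndep_wtSp : iSupIndep G.wtSp := iSupIndep_wtSpaceι fun v w => G.abelian v w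

lemma e_mem (i : I) : G.e i ∈ G.wtSp (G.root i) := fun h => G.lie_e h i

lemma f_mem (i : I) : G.f i ∈ G.wtSp (-G.root i) := fun h => by
  simpa using G.lie_f h i

lemma mem_wtSp_zero {x : g} : x ∈ G.wtSp 0 ↔ x ∈ G.H := by rw [wtSp, G.zero_weight]

variable {G}

lemma mem_of_generators {K : LieSubalgebra ℂ g} (hH : ∀ h : G.H, (h : g) ∈ K)
    (he : ∀ i, G.e i ∈ K) (hf : ∀ i, G.f i ∈ K) (x : g) : x ∈ K := by
  have : LieSubalgebra.lieSpan ℂ g ((G.H : Set g) ∪ Set.range G.e ∪ Set.range G.f) ≤ K := by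
    rw [LieSubalgebra.lieSpan_le]
    rintro x ((hx | ⟨i, rfl⟩) | ⟨i, rfl⟩)
    · exact hH ⟨x, hx⟩
    · exact he i
    · exact hf i
  exact this (by rw [G.generates]; trivial)

section Tower

variable {W : Type*} [AddCommGroup W] [Module ℂ W] [LieRingModule g W] [LieModule ℂ g W]

/-- The submodules obtained from `V0` by applying `n` times the elements `a i`. -/
def tower {J : Type*} (a : J → g) (V0 : Submodule ℂ W) : ℕ → Submodule ℂ W
  | 0 => V0
  | n + 1 => ⨆ i, (tower a V0 n).map (LieModule.toEnd ℂ g W (a i))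

lemma lie_mem_tower_succ {J : Type*} (a : J → g) (V0 : Submodule ℂ W) (n : ℕ) (i : J) {w : W}
    (hw : w ∈ tower a V0 n) : ⁅a i, w⁆ ∈ tower a V0 (n + 1) :=
  (le_iSup (fun i => (tower a V0 n).map (LieModule.toEnd ℂ g W (a i))) i)
    (Submodule.mem_map_of_mem hw)

lemma tower_succ_le {J : Type*} {a : J → g} {V0 : Submodule ℂ W} {n : ℕ} {U : Submodule ℂ W}
    (h : ∀ i, ∀ w ∈ tower a V0 n, ⁅a i, w⁆ ∈ U) : tower a V0 (n + 1) ≤ U := by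
  refine iSup_le fun i => ?_
  rintro _ ⟨w, hw, rfl⟩
  exact h i w hw

lemma lie_H_mem_tower {a : I → g} {V0 : Submodule ℂ W}
    (ha : ∀ (h : G.H) i, ∃ c : ℂ, ⁅(h : g), a i⁆ = c • a i)
    (h0 : ∀ h : G.H, ∀ w ∈ V0, ⁅(h : g), w⁆ ∈ V0) (n : ℕ) (h : G.H) {w : W}
    (hw : w ∈ tower a V0 n) : ⁅(h : g), w⁆ ∈ tower a V0 n := by
  induction n generalizing w with
  | zero => exact h0 h w hw
  | succ n ih =>
    refine (tower_succ_le (a := a) (V0 := V0) (n := n)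
      (U := (tower a V0 (n + 1)).comap (LieModule.toEnd ℂ g W (h : g)))
      fun i w hw => ?_) hw
    change ⁅(h : g), ⁅a i, w⁆⁆ ∈ tower a V0 (n + 1)
    obtain ⟨c, hc⟩ := ha h i
    rw [leibniz_lie, hc, smul_lie]
    exact add_mem (Submodule.smul_mem _ _ (lie_mem_tower_succ a V0 n i hw))
      (lie_mem_tower_succ a V0 n i (ih hw))

lemma lie_mem_tower_of_succ {a b : I → g} {V0 : Submodule ℂ W}
    (ha : ∀ (h : G.H) i, ∃ c : ℂ, ⁅(h : g), a i⁆ = c • a i)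
    (hba : ∀ i j, ⁅b j, a i⁆ ∈ G.H)
    (h0 : ∀ h : G.H, ∀ w ∈ V0, ⁅(h : g), w⁆ ∈ V0)
    (h1 : ∀ i j, ∀ w ∈ V0, ⁅b j, ⁅a i, w⁆⁆ ∈ V0) (n : ℕ) (j : I) {w : W}
    (hw : w ∈ tower a V0 (n + 1)) : ⁅b j, w⁆ ∈ tower a V0 n := by
  induction n generalizing w with
  | zero =>
    exact (tower_succ_le (a := a) (V0 := V0) (n := 0) (U := V0.comap (LieModule.toEnd ℂ g W (b j)))
      fun i w hw => h1 i j w hw) hw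
  | succ n ih =>
    refine (tower_succ_le (a := a) (V0 := V0) (n := n + 1)
      (U := (tower a V0 (n + 1)).comap (LieModule.toEnd ℂ g W (b j)))
      fun i w hw => ?_) hw
    change ⁅b j, ⁅a i, w⁆⁆ ∈ tower a V0 (n + 1)
    rw [leibniz_lie]
    exact add_mem (lie_H_mem_tower ha h0 _ ⟨_, hba i j⟩ hw)
      (lie_mem_tower_succ a V0 n i (ih hw))

variable (G) in
/-- The submodule generated by `V0` under suitable stability assumptions. -/
def hull (V0 : Submodule ℂ W) : Submodule ℂ W :=
  (⨆ n, tower G.e V0 n) ⊔ ⨆ n, tower G.f V0 n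

variable (G) in
/-- The assumptions on `V0` making `hull V0` stable under the Lie algebra. -/
structure Seed (V0 : Submodule ℂ W) : Prop where
  lie_H : ∀ h : G.H, ∀ w ∈ V0, ⁅(h : g), w⁆ ∈ V0
  lie_f_e : ∀ i j, ∀ w ∈ V0, ⁅G.f j, ⁅G.e i, w⁆⁆ ∈ V0
  lie_e_f : ∀ i j, ∀ w ∈ V0, ⁅G.e j, ⁅G.f i, w⁆⁆ ∈ V0

lemma e_f_mem (i j : I) : ⁅G.e i, G.f j⁆ ∈ G.H := by
  rw [G.e_f]
  split_ifs
  · exact (G.coroot i).2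
  · exact zero_mem _

lemma f_e_mem (i j : I) : ⁅G.f i, G.e j⁆ ∈ G.H := by
  rw [← lie_skew]
  exact neg_mem (e_f_mem j i)

lemma exists_lie_e (h : G.H) (i : I) : ∃ c : ℂ, ⁅(h : g), G.e i⁆ = c • G.e i := ⟨_, G.lie_e h i⟩

lemma exists_lie_f (h : G.H) (i : I) : ∃ c : ℂ, ⁅(h : g), G.f i⁆ = c • G.f i := ⟨_, G.lie_f h i⟩

variable {V0 : Submodule ℂ W}

lemma Seed.f_mem (hV : Seed G V0) (n : ℕ) (j : I) {w : W} (hw : w ∈ tower G.e V0 (n + 1)) :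
    ⁅G.f j, w⁆ ∈ tower G.e V0 n :=
  lie_mem_tower_of_succ exists_lie_e (fun i j => f_e_mem j i) hV.lie_H hV.lie_f_e n j hw

lemma Seed.e_mem (hV : Seed G V0) (n : ℕ) (j : I) {w : W} (hw : w ∈ tower G.f V0 (n + 1)) :
    ⁅G.e j, w⁆ ∈ tower G.f V0 n :=
  lie_mem_tower_of_succ exists_lie_f (fun i j => e_f_mem j i) hV.lie_H hV.lie_e_f n j hw

lemma tower_e_le_hull (n : ℕ) : tower G.e V0 n ≤ hull G V0 :=
  (le_iSup (tower G.e V0) n).trans le_sup_left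

lemma tower_f_le_hull (n : ℕ) : tower G.f V0 n ≤ hull G V0 :=
  (le_iSup (tower G.f V0) n).trans le_sup_right

lemma le_hull : V0 ≤ hull G V0 := tower_e_le_hull (V0 := V0) (G := G) 0

lemma hull_le {U : Submodule ℂ W} (h1 : ∀ n, tower G.e V0 n ≤ U)
    (h2 : ∀ n, tower G.f V0 n ≤ U) : hull G V0 ≤ U :=
  sup_le (iSup_le h1) (iSup_le h2)

/-- The elements of the Lie algebra stabilizing a subspace of a module. -/
def stab (U : Submodule ℂ W) : LieSubalgebra ℂ g where
  carrier := {x | ∀ w ∈ U, ⁅x, w⁆ ∈ U}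
  add_mem' hx hy w hw := by rw [add_lie]; exact add_mem (hx w hw) (hy w hw)
  zero_mem' w _ := by rw [zero_lie]; exact zero_mem _
  smul_mem' c x hx w hw := by rw [smul_lie]; exact U.smul_mem _ (hx w hw)
  lie_mem' hx hy w hw := by
    rw [lie_lie]; exact sub_mem (hx _ (hy w hw)) (hy _ (hx w hw))

lemma Seed.lie_mem_hull (hV : Seed G V0) (x : g) {w : W} (hw : w ∈ hull G V0) :
    ⁅x, w⁆ ∈ hull G V0 := by
  have hstab : ∀ x : g, (∀ n, ∀ w ∈ tower G.e V0 n, ⁅x, w⁆ ∈ hull G V0) →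
      (∀ n, ∀ w ∈ tower G.f V0 n, ⁅x, w⁆ ∈ hull G V0) → x ∈ stab (g := g) (hull G V0) := by
    intro x h1 h2 w hw
    exact (hull_le (U := (hull G V0).comap (LieModule.toEnd ℂ g W x)) h1 h2) hw
  refine mem_of_generators (G := G) (K := stab (hull G V0)) (fun h => ?_) (fun i => ?_)
    (fun i => ?_) x w hw
  · exact hstab _ (fun n w hw => tower_e_le_hull n (lie_H_mem_tower exists_lie_e hV.lie_H n h hw))
      (fun n w hw => tower_f_le_hull n (lie_H_mem_tower exists_lie_f hV.lie_H n h hw))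
  · refine hstab _ (fun n w hw => tower_e_le_hull _ (lie_mem_tower_succ _ _ n i hw))
      fun n w hw => ?_
    cases n with
    | zero => exact tower_e_le_hull 1 (lie_mem_tower_succ G.e V0 0 i hw)
    | succ n => exact tower_f_le_hull _ (hV.e_mem n i hw)
  · refine hstab _ (fun n w hw => ?_)
      (fun n w hw => tower_f_le_hull _ (lie_mem_tower_succ _ _ n i hw))
    cases n with
    | zero => exact tower_f_le_hull 1 (lie_mem_tower_succ G.f V0 0 i hw)
    | succ n => exact tower_e_le_hull _ (hV.f_mem n i hw)

end Tower

end KacMoodyAlgebra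

end KacMoody

section Adjoint

variable {I : Type*} [Fintype I] [DecidableEq I] {A : Matrix I I ℤ}
variable {g : Type*} [LieRing g] [LieAlgebra ℂ g]

namespace KacMoodyAlgebra

variable {G : KacMoodyAlgebra A g}

lemma lie_e_H (i : I) {w : g} (hw : w ∈ G.H) :
    ⁅G.e i, w⁆ = -(G.root i ⟨w, hw⟩) • G.e i := by
  rw [← lie_skew, neg_smul, ← G.lie_e]

lemma lie_f_H (i : I) {w : g} (hw : w ∈ G.H) :
    ⁅G.f i, w⁆ = G.root i ⟨w, hw⟩ • G.f i := by
  rw [← lie_skew, ← neg_neg (G.root i ⟨w, hw⟩), neg_smul, ← G.lie_f ⟨w, hw⟩ i]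

lemma seed_adjoint {V0 : Submodule ℂ g} (h1 : ∀ i, (G.coroot i : g) ∈ V0) (h2 : V0 ≤ G.H) :
    Seed G V0 := by
  have hef : ∀ i j, ⁅G.e i, G.f j⁆ ∈ V0 := by
    intro i j
    rw [G.e_f]
    split_ifs
    exacts [h1 i, zero_mem _]
  refine ⟨fun h w hw => ?_, fun i j w hw => ?_, fun i j w hw => ?_⟩
  · rw [G.abelian h ⟨w, h2 hw⟩]
    exact zero_mem _
  · rw [lie_e_H i (h2 hw), lie_smul, ← lie_skew]
    exact V0.smul_mem _ (neg_mem (hef i j))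
  · rw [lie_f_H i (h2 hw), lie_smul]
    exact V0.smul_mem _ (hef j i)

lemma e_mem_hull (hA : IsGCM A) {V0 : Submodule ℂ g} (h1 : ∀ i, (G.coroot i : g) ∈ V0)
    (h2 : V0 ≤ G.H) (i : I) : G.e i ∈ hull G V0 := by
  have h3 := (seed_adjoint h1 h2).lie_mem_hull (G.e i) (le_hull (h1 i))
  rw [lie_e_H i (G.coroot i).2] at h3
  have h4 := (hull G V0).smul_mem (-1 / 2) h3
  rw [smul_smul] at h4
  convert h4
  rw [Subtype.coe_eta, G.pairing, hA.1]
  norm_num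

lemma f_mem_hull (hA : IsGCM A) {V0 : Submodule ℂ g} (h1 : ∀ i, (G.coroot i : g) ∈ V0)
    (h2 : V0 ≤ G.H) (i : I) : G.f i ∈ hull G V0 := by
  have h3 := (seed_adjoint h1 h2).lie_mem_hull (G.f i) (le_hull (h1 i))
  rw [lie_f_H i (G.coroot i).2] at h3
  have h4 := (hull G V0).smul_mem (1 / 2) h3
  rw [smul_smul] at h4
  convert h4
  rw [Subtype.coe_eta, G.pairing, hA.1]
  norm_num

variable (G) in
lemma H_sup_hull (hA : IsGCM A) {V0 : Submodule ℂ g} (h1 : ∀ i, (G.coroot i : g) ∈ V0)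
    (h2 : V0 ≤ G.H) (x : g) : x ∈ G.H ⊔ hull G V0 := by
  let K : LieSubalgebra ℂ g :=
    { G.H ⊔ hull G V0 with
      lie_mem' := by
        intro x y hx hy
        obtain ⟨a, ha, b, hb, rfl⟩ := Submodule.mem_sup.mp hx
        obtain ⟨c, hc, d, hd, rfl⟩ := Submodule.mem_sup.mp hy
        refine (le_sup_right : hull G V0 ≤ G.H ⊔ hull G V0) ?_
        rw [add_lie, lie_add a c d, G.abelian ⟨a, ha⟩ ⟨c, hc⟩, zero_add]
        have h3 := (seed_adjoint h1 h2).lie_mem_hull (c + d) hb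
        rw [← lie_skew] at h3
        exact add_mem ((seed_adjoint h1 h2).lie_mem_hull a hd) (neg_mem_iff.mp h3) }
  exact mem_of_generators (G := G) (K := K)
    (fun h => (le_sup_left : G.H ≤ G.H ⊔ hull G V0) h.2)
    (fun i => (le_sup_right : hull G V0 ≤ G.H ⊔ hull G V0) (e_mem_hull hA h1 h2 i))
    (fun i => (le_sup_right : hull G V0 ≤ G.H ⊔ hull G V0) (f_mem_hull hA h1 h2 i)) x

lemma lie_mem_hull (hA : IsGCM A) {V0 : Submodule ℂ g} (h1 : ∀ i, (G.coroot i : g) ∈ V0)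
    (h2 : V0 ≤ G.H) (x y : g) : ⁅x, y⁆ ∈ hull G V0 := by
  have hs := seed_adjoint h1 h2
  obtain ⟨a, ha, b, hb, rfl⟩ := Submodule.mem_sup.mp (G.H_sup_hull hA h1 h2 x)
  obtain ⟨c, hc, d, hd, rfl⟩ := Submodule.mem_sup.mp (G.H_sup_hull hA h1 h2 y)
  rw [add_lie, lie_add a c d, G.abelian ⟨a, ha⟩ ⟨c, hc⟩, zero_add]
  have h3 := hs.lie_mem_hull (c + d) hb
  rw [← lie_skew] at h3
  exact add_mem (hs.lie_mem_hull a hd) (neg_mem_iff.mp h3)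

variable (G) in
lemma hull_H_eq_top (hA : IsGCM A) : hull G G.H = ⊤ := by
  refine eq_top_iff.mpr fun x _ => ?_
  have := G.H_sup_hull hA (V0 := G.H) (fun i => (G.coroot i).2) le_rfl x
  rwa [sup_eq_right.mpr le_hull] at this

lemma tower_le_wt (ε : ℤ) {a : I → g}
    (ha : ∀ i, a i ∈ G.wtSp (G.wt (ε • Pi.single i 1))) {V0 : Submodule ℂ g} (h2 : V0 ≤ G.H)
    (n : ℕ) : tower a V0 n ≤
      ⨆ v ∈ {v : I → ℤ | (∀ i, 0 ≤ v i) ∧ ∑ i, v i = n}, G.wtSp (G.wt (ε • v)) := by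
  induction n with
  | zero =>
    refine le_trans (fun x hx => ?_) (le_biSup (fun v => G.wtSp (G.wt (ε • v)))
      (show (0 : I → ℤ) ∈ _ from ⟨fun _ => le_rfl, by simp⟩))
    rw [smul_zero, map_zero, mem_wtSp_zero]
    exact h2 hx
  | succ n ih =>
    refine tower_succ_le fun i w hw => ?_
    have h3 : ∀ w ∈ ⨆ v ∈ {v : I → ℤ | (∀ i, 0 ≤ v i) ∧ ∑ i, v i = n},
        G.wtSp (G.wt (ε • v)), ⁅a i, w⁆ ∈
          ⨆ v ∈ {v : I → ℤ | (∀ i, 0 ≤ v i) ∧ ∑ i, v i = (n + 1 : ℕ)},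
            G.wtSp (G.wt (ε • v)) := by
      suffices h : (⨆ v ∈ {v : I → ℤ | (∀ i, 0 ≤ v i) ∧ ∑ i, v i = n},
          G.wtSp (G.wt (ε • v))) ≤ Submodule.comap (LieAlgebra.ad ℂ g (a i))
          (⨆ v ∈ {v : I → ℤ | (∀ i, 0 ≤ v i) ∧ ∑ i, v i = (n + 1 : ℕ)},
            G.wtSp (G.wt (ε • v))) from fun w hw => h hw
      refine iSup₂_le fun v hv w hw => ?_
      have h4 := lie_mem_wtSpaceι (ha i) hw
      rw [← map_add, ← smul_add] at h4
      refine (le_biSup (fun v => G.wtSp (G.wt (ε • v))) (show Pi.single i 1 + v ∈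
        {v : I → ℤ | (∀ i, 0 ≤ v i) ∧ ∑ i, v i = (n + 1 : ℕ)} from ⟨fun j => ?_, ?_⟩)) h4
      · exact add_nonneg (by rw [Pi.single_apply]; split_ifs <;> simp) (hv.1 j)
      · simp [Finset.sum_add_distrib, hv.2, add_comm]
    exact h3 w (ih hw)

variable (G) in
/-- Nonzero elements of the root lattice with coordinates of a constant sign. -/
def signedWts : Set (Module.Dual ℂ G.H) :=
  {χ | χ ≠ 0 ∧ ∃ v : I → ℤ, χ = G.wt v ∧ ((∀ i, 0 ≤ v i) ∨ ∀ i, v i ≤ 0)}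

lemma tower_le_signed (ε : ℤ) (hε : ε = 1 ∨ ε = -1) {a : I → g}
    (ha : ∀ i, a i ∈ G.wtSp (G.wt (ε • Pi.single i 1))) {V0 : Submodule ℂ g} (h2 : V0 ≤ G.H)
    (n : ℕ) : tower a V0 n ≤ V0 ⊔ ⨆ χ ∈ G.signedWts, G.wtSp χ := by
  cases n with
  | zero => exact le_sup_left
  | succ n =>
    refine le_trans (tower_le_wt ε ha h2 (n + 1)) (le_sup_of_le_right ?_)
    refine iSup₂_le fun v hv => le_biSup G.wtSp ⟨fun h0 => ?_, ε • v, rfl, ?_⟩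
    · have hv0 : v = 0 := by
        have := (map_eq_zero_iff G.wt G.wt_injective).mp h0
        rcases hε with rfl | rfl <;> simpa using this
      have := hv.2
      rw [hv0] at this
      simp only [Pi.zero_apply, Finset.sum_const_zero] at this
      omega
    · rcases hε with rfl | rfl
      · left; simpa using hv.1
      · right; simpa using hv.1

lemma hull_le_signed {V0 : Submodule ℂ g} (h2 : V0 ≤ G.H) :
    hull G V0 ≤ V0 ⊔ ⨆ χ ∈ G.signedWts, G.wtSp χ := by
  refine hull_le (tower_le_signed 1 (.inl rfl) (fun i => ?_) h2)
    (tower_le_signed (-1) (.inr rfl) (fun i => ?_) h2)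
  · rw [one_smul, wt_single]; exact G.e_mem i
  · rw [neg_smul, one_smul, map_neg, wt_single]; exact G.f_mem i

/-- Every weight is an integral combination of simple roots with coefficients of constant
sign. -/
lemma exists_wt_of_ne_bot (hA : IsGCM A) {χ : Module.Dual ℂ G.H} (hχ : G.wtSp χ ≠ ⊥) :
    ∃ v : I → ℤ, χ = G.wt v ∧ ((∀ i, 0 ≤ v i) ∨ ∀ i, v i ≤ 0) := by
  have h1 : ⨆ χ ∈ insert 0 G.signedWts, G.wtSp χ = ⊤ := by
    rw [iSup_insert, eq_top_iff, ← G.hull_H_eq_top hA, wtSp, G.zero_weight]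
    exact hull_le_signed le_rfl
  rcases G.iSupIndep_wtSp.mem_of_biSup_eq_top h1 hχ with rfl | h
  · exact ⟨0, by simp, by simp⟩
  · exact h.2

lemma sign_of_wtSp_ne_bot (hA : IsGCM A) {v : I → ℤ} (hv : G.wtSp (G.wt v) ≠ ⊥) :
    (∀ i, 0 ≤ v i) ∨ ∀ i, v i ≤ 0 := by
  obtain ⟨w, hw, h⟩ := exists_wt_of_ne_bot hA hv
  rwa [G.wt_injective hw]

lemma disjoint_H_signed : Disjoint G.H (⨆ χ ∈ G.signedWts, G.wtSp χ) := by
  have := G.iSupIndep_wtSp.disjoint_biSup (x := 0) (y := G.signedWts) fun h => h.1 rfl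
  rwa [wtSp, G.zero_weight] at this

lemma mem_of_mem_hull {V0 : Submodule ℂ g} (h2 : V0 ≤ G.H) {x : g} (hx : x ∈ G.H)
    (hx' : x ∈ hull G V0) : x ∈ V0 := by
  obtain ⟨p, hp, r, hr, rfl⟩ := Submodule.mem_sup.mp (hull_le_signed h2 hx')
  have hr' : r ∈ G.H := by simpa using sub_mem hx (h2 hp)
  rw [Submodule.disjoint_def.mp disjoint_H_signed r hr' hr, add_zero]
  exact hp

/-- A bracket lying in the Cartan subalgebra is a combination of coroots. -/
lemma exists_coroot_coeffs (hA : IsGCM A) {x y : g} {h : G.H} (hxy : ⁅x, y⁆ = h) :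
    ∃ c : I → ℂ, h = ∑ i, c i • G.coroot i := by
  have h1 : (h : g) ∈ (Submodule.span ℂ (Set.range G.coroot)).map G.H.subtype := by
    refine mem_of_mem_hull (G := G) ?_ h.2 ?_
    · rintro _ ⟨z, -, rfl⟩; exact z.2
    · rw [← hxy]
      refine lie_mem_hull hA
        (fun i => Submodule.mem_map_of_mem (Submodule.subset_span (Set.mem_range_self i))) ?_ x y
      rintro _ ⟨z, -, rfl⟩; exact z.2
  obtain ⟨z, hz, hzh⟩ := h1
  obtain rfl : z = h := Subtype.ext hzh
  obtain ⟨c, hc⟩ := (Submodule.mem_span_range_iff_exists_fun ℂ).mp hz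
  exact ⟨c, hc.symm⟩

lemma lie_eq_zero_of_root_eq_zero {y : G.H} (hy : ∀ i, G.root i y = 0) (z : g) :
    ⁅(y : g), z⁆ = 0 := by
  let K : LieSubalgebra ℂ g :=
    { LinearMap.ker (LieAlgebra.ad ℂ g (y : g)) with
      lie_mem' := by
        intro a b (ha : ⁅(y : g), a⁆ = 0) (hb : ⁅(y : g), b⁆ = 0)
        change ⁅(y : g), ⁅a, b⁆⁆ = 0
        rw [leibniz_lie, ha, hb, zero_lie, lie_zero, add_zero] }
  refine mem_of_generators (G := G) (K := K) (fun h => G.abelian y h) (fun i => ?_)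
    (fun i => ?_) z
  · change ⁅(y : g), G.e i⁆ = 0
    rw [G.lie_e, hy, zero_smul]
  · change ⁅(y : g), G.f i⁆ = 0
    rw [G.lie_f, hy, neg_zero, zero_smul]

variable (G) in
lemma exists_ad_f_pow_eq_zero (i : I) (z : g) :
    ∃ n : ℕ, ((LieAlgebra.ad ℂ g (G.f i)) ^ n) z = 0 := by
  rw [← LieSubalgebra.mem_engel_iff]
  refine mem_of_generators (G := G) (fun h => ?_) (fun j => ?_) (fun j => ?_) z
  · rw [LieSubalgebra.mem_engel_iff]
    refine ⟨2, ?_⟩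
    simp [pow_two, lie_f_H i h.2]
  · rw [LieSubalgebra.mem_engel_iff]
    refine ⟨3, ?_⟩
    have h1 : ⁅G.f i, G.e j⁆ ∈ G.H := f_e_mem i j
    simp [pow_succ, lie_f_H i h1]
  · rcases eq_or_ne i j with rfl | hij
    · exact LieSubalgebra.self_mem_engel ℂ _
    · rw [LieSubalgebra.mem_engel_iff]
      exact ⟨_, G.serre_f i j hij⟩

variable (G) in
lemma isSl2Triple (hA : IsGCM A) (i : I) : IsSl2Triple (G.coroot i : g) (G.e i) (G.f i) where
  h_ne_zero h := G.indepCoroot.ne_zero i (Subtype.ext h)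
  lie_e_f := by rw [G.e_f, if_pos rfl]
  lie_h_e_nsmul := by
    rw [G.lie_e, G.pairing, hA.1, ← Nat.cast_smul_eq_nsmul ℂ]; norm_num
  lie_h_f_nsmul := by
    rw [G.lie_f, G.pairing, hA.1, ← Nat.cast_smul_eq_nsmul ℂ, neg_smul]; norm_num

lemma pow_ad_mem {χ ψ : Module.Dual ℂ G.H} {a x : g} (ha : a ∈ G.wtSp ψ) (hx : x ∈ G.wtSp χ)
    (k : ℕ) : ((LieAlgebra.ad ℂ g a) ^ k) x ∈ G.wtSp (χ + k • ψ) := by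
  induction k with
  | zero => simpa using hx
  | succ k ih =>
    rw [pow_succ', Module.End.mul_apply]
    have := lie_mem_wtSpaceι ha ih
    rwa [show ψ + (χ + k • ψ) = χ + (k + 1) • ψ by rw [succ_nsmul]; abel] at this

/-- Root strings: if `χ` is a weight with `⟨χ, α_i∨⟩ = -n ≤ 0` then `χ, χ + α_i, …, χ + n α_i`
are weights. -/
lemma wtSp_add_smul_root_ne_bot (hA : IsGCM A) {χ : Module.Dual ℂ G.H} (hχ : G.wtSp χ ≠ ⊥)
    (i : I) (n : ℕ) (hn : χ (G.coroot i) = -n) (j : ℕ) (hj : j ≤ n) :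
    G.wtSp (χ + j • G.root i) ≠ ⊥ := by
  obtain ⟨x, hx, hx0⟩ := (Submodule.ne_bot_iff _).mp hχ
  have hex := G.exists_ad_f_pow_eq_zero i x
  obtain ⟨k, hk⟩ : ∃ k, Nat.find hex = k + 1 := Nat.exists_eq_succ_of_ne_zero fun h => by
    have := Nat.find_spec hex
    rw [h] at this
    exact hx0 (by simpa using this)
  set w := ((LieAlgebra.ad ℂ g (G.f i)) ^ k) x with hw
  have hw0 : w ≠ 0 := Nat.find_min hex (by omega)
  have hfw : ⁅G.f i, w⁆ = 0 := by
    have := Nat.find_spec hex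
    rwa [hk, pow_succ'] at this
  have hwχ : w ∈ G.wtSp (χ + k • -G.root i) := pow_ad_mem (G.f_mem i) hx k
  have hP : (G.isSl2Triple hA i).symm.HasPrimitiveVectorWith w ((n + 2 * k : ℕ) : ℂ) :=
    { ne_zero := hw0
      lie_h := by
        rw [neg_lie, G.mem_wtSp.mp hwχ (G.coroot i), ← neg_smul]
        congr 1
        simp [hn, G.pairing, hA.1]
        ring
      lie_e := hfw }
  have hne : ∀ l ≤ n + 2 * k, ((LieAlgebra.ad ℂ g (G.e i)) ^ l) w ≠ 0 := by
    intro l hl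
    induction l with
    | zero => simpa using hw0
    | succ l ih =>
      intro h0
      have h1 := hP.lie_e_pow_succ_toEnd_f l
      change ⁅G.f i, ((LieAlgebra.ad ℂ g (G.e i)) ^ (l + 1)) w⁆ =
        _ • ((LieAlgebra.ad ℂ g (G.e i)) ^ l) w at h1
      rw [h0, lie_zero] at h1
      rcases smul_eq_zero.mp h1.symm with h2 | h2
      · rcases mul_eq_zero.mp h2 with h3 | h3
        · exact Nat.cast_add_one_ne_zero l h3
        · have : (n + 2 * k : ℕ) = l := by exact_mod_cast sub_eq_zero.mp h3
          omega
      · exact ih (by omega) h2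
  refine (Submodule.ne_bot_iff _).mpr ⟨_, ?_, hne (k + j) (by omega)⟩
  have := pow_ad_mem (G.e_mem i) hwχ (k + j)
  convert this using 2
  rw [add_nsmul, smul_neg]
  abel

end KacMoodyAlgebra

end Adjoint

section ImaginaryRoots

variable {I : Type*} {A : Matrix I I ℤ}

/-- The Gram matrix of the symmetrized form. -/
abbrev gram (d : I → ℚ) (A : Matrix I I ℤ) : I → I → ℚ := fun i j => d i * (A i j : ℚ)

/-- An integral vector seen as a rational one. -/
def castQ (v : I → ℤ) : I → ℚ := fun i => v i

lemma castQ_add (v w : I → ℤ) : castQ (v + w) = castQ v + castQ w := by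
  ext; simp [castQ]

lemma castQ_sub (v w : I → ℤ) : castQ (v - w) = castQ v - castQ w := by
  ext; simp [castQ]

lemma castQ_single [DecidableEq I] (i : I) : castQ (Pi.single i 1) = Pi.single i 1 := by
  ext j; simp only [castQ, Pi.single_apply]; split_ifs <;> simp

lemma castQ_smul (n : ℤ) (v : I → ℤ) : castQ (n • v) = (n : ℚ) • castQ v := by
  ext; simp [castQ]

variable [Fintype I]

lemma bf_gram_single [DecidableEq I] (d : I → ℚ) (A : Matrix I I ℤ) (i : I) (v : I → ℤ) :
    bf (gram d A) (Pi.single i 1) (castQ v) = d i * ((∑ j, A i j * v j : ℤ) : ℚ) := by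
  rw [bf_single_left, Int.cast_sum, Finset.mul_sum]
  exact Finset.sum_congr rfl fun j _ => by simp only [castQ]; push_cast; ring

lemma sum_mul_nonpos_of_eq_zero (hA : IsGCM A) {v : I → ℤ} (hv : ∀ i, 0 ≤ v i) {i : I}
    (hi : v i = 0) : ∀ j ∈ Finset.univ, A i j * v j ≤ 0 := by
  intro j _
  rcases eq_or_ne i j with rfl | hij
  · simp [hi]
  · exact mul_nonpos_of_nonpos_of_nonneg (hA.2.1 i j hij) (hv j)

lemma sum_mul_neg_of_eq_zero (hA : IsGCM A) {v : I → ℤ} (hv : ∀ i, 0 ≤ v i) {i j : I}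
    (hi : v i = 0) (hij : A i j ≠ 0) (hj : v j ≠ 0) : ∑ j, A i j * v j < 0 := by
  refine Finset.sum_neg' (sum_mul_nonpos_of_eq_zero hA hv hi) ⟨j, Finset.mem_univ _, ?_⟩
  exact lt_of_le_of_ne (sum_mul_nonpos_of_eq_zero hA hv hi j (Finset.mem_univ _))
    (mul_ne_zero hij hj)

namespace KacMoodyAlgebra

variable [DecidableEq I] {g : Type*} [LieRing g] [LieAlgebra ℂ g]
variable {G : KacMoodyAlgebra A g}

lemma wt_coroot (v : I → ℤ) (i : I) :
    G.wt v (G.coroot i) = ((∑ j, A i j * v j : ℤ) : ℂ) := by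
  rw [wt_apply]
  simp [G.pairing, mul_comm]

variable (G) in
lemma wtSp_single_ne_bot (hA : IsGCM A) (i : I) : G.wtSp (G.wt (Pi.single i 1)) ≠ ⊥ :=
  (Submodule.ne_bot_iff _).mpr
    ⟨G.e i, by rw [wt_single]; exact G.e_mem i, (G.isSl2Triple hA i).e_ne_zero⟩

/-- A weight with positive coordinates which is antidominant and of negative norm is a root. -/
lemma wtSp_ne_bot_of_antidominant (hA : IsGCM A) (hInd : Indecomposable A) {d : I → ℚ}
    (hd : ∀ i, 0 < d i) (hsym : ∀ i j, d i * (A i j : ℚ) = d j * (A j i : ℚ))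
    (hprop : ∀ x : I → ℚ, ∀ i₀, x i₀ = 0 → 0 ≤ bf (gram d A) x x) {v : I → ℤ}
    (hv0 : ∀ i, 0 < v i) (hv : bf (gram d A) (castQ v) (castQ v) < 0)
    (hanti : ∀ i, ∑ j, A i j * v j ≤ 0) : G.wtSp (G.wt v) ≠ ⊥ := by
  set Ω : Set (I → ℤ) := {β | (0 ≤ β ∧ β ≤ v) ∧ β ≠ 0 ∧ G.wtSp (G.wt β) ≠ ⊥} with hΩ
  have hfin : Ω.Finite := (Set.finite_Icc (0 : I → ℤ) v).subset fun β hβ => hβ.1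
  obtain ⟨k, hk⟩ : ∃ i, bf (gram d A) (Pi.single i 1) (castQ v) < 0 := by
    by_contra! h
    refine hv.not_ge ?_
    rw [bf_eq_sum_single]
    exact Finset.sum_nonneg fun i _ => mul_nonneg (by simpa [castQ] using (hv0 i).le) (h i)
  have hvn : ∀ i, bf (gram d A) (Pi.single i 1) (castQ v) ≤ 0 := by
    intro i
    rw [bf_gram_single]
    exact mul_nonpos_of_nonneg_of_nonpos (hd i).le (by exact_mod_cast hanti i)
  have hne : Ω.Nonempty := by
    refine ⟨Pi.single k 1, ⟨?_, ?_⟩, ?_, G.wtSp_single_ne_bot hA k⟩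
    · exact Pi.single_nonneg.mpr zero_le_one
    · intro i
      rw [Pi.single_apply]
      split_ifs
      · exact hv0 i
      · exact (hv0 i).le
    · intro h
      have := congrFun h k
      simp at this
  obtain ⟨β, hβ, hmax⟩ := hfin.exists_maximalFor (fun β => ∑ i, β i) Ω hne
  have hβ0 : ∀ i, 0 ≤ β i := hβ.1.1
  have hβv : ∀ i, β i ≤ v i := hβ.1.2
  have hdom : ∀ i, β i < v i → 0 ≤ ∑ j, A i j * β j := by
    intro i hi
    by_contra! hneg
    have h1 := wtSp_add_smul_root_ne_bot hA hβ.2.2 i (-∑ j, A i j * β j).toNat (by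
      rw [wt_coroot]
      have : ((-∑ j, A i j * β j).toNat : ℤ) = -∑ j, A i j * β j :=
        Int.toNat_of_nonneg (by omega)
      have h2 : (((-∑ j, A i j * β j).toNat : ℤ) : ℂ) = ((-∑ j, A i j * β j : ℤ) : ℂ) := by
        rw [this]
      rw [Int.cast_natCast] at h2
      rw [h2, Int.cast_neg, neg_neg]) 1 (by omega)
    rw [one_nsmul, ← wt_single, ← map_add] at h1
    have h2 : β + Pi.single i 1 ∈ Ω := by
      refine ⟨⟨add_nonneg hβ.1.1 (Pi.single_nonneg.mpr zero_le_one), fun j => ?_⟩, ?_, h1⟩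
      · rw [Pi.add_apply, Pi.single_apply]
        split_ifs with h
        · rw [h]; exact hi
        · simpa using hβv j
      · intro h
        have := congrFun h i
        simp only [Pi.add_apply, Pi.single_eq_same, Pi.zero_apply] at this
        have := hβ0 i
        omega
    have h3 := hmax h2
    simp [Finset.sum_add_distrib] at h3
  have hβpos : ∀ i, 0 < β i := by
    by_contra! h
    obtain ⟨i, hi⟩ := h
    obtain ⟨j, hj⟩ := Function.ne_iff.mp hβ.2.1
    obtain ⟨a, ha, b, hb, hab⟩ := hInd {i | β i = 0} ⟨i, le_antisymm hi (hβ0 i)⟩ ⟨j, hj⟩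
    have ha : β a = 0 := ha
    exact (hdom a (ha ▸ hv0 a)).not_gt (sum_mul_neg_of_eq_zero hA hβ0 ha hab hb)
  have hdom' : ∀ i, β i < v i → 0 ≤ bf (gram d A) (Pi.single i 1) (castQ β) := by
    intro i hi
    rw [bf_gram_single]
    exact mul_nonneg (hd i).le (by exact_mod_cast hdom i hi)
  by_cases hall : ∀ i, β i = v i
  · rw [← funext hall]; exact hβ.2.2
  exfalso
  push Not at hall
  obtain ⟨l, hl⟩ := hall
  by_cases hP : ∃ i, β i = v i
  · obtain ⟨p, hp⟩ := hP
    have hγ0 : ∀ i, 0 ≤ (v - β) i := fun i => sub_nonneg.mpr (hβv i)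
    have hγsplit : ∀ i, bf (gram d A) (Pi.single i 1) (castQ (v - β)) =
        bf (gram d A) (Pi.single i 1) (castQ v) - bf (gram d A) (Pi.single i 1) (castQ β) := by
      intro i; rw [castQ_sub, map_sub]
    have hγn : ∀ i, bf (gram d A) (Pi.single i 1) (castQ (v - β)) ≤ 0 := by
      intro i
      rcases eq_or_ne (β i) (v i) with h | h
      · rw [bf_gram_single]
        exact mul_nonpos_of_nonneg_of_nonpos (hd i).le (by
          exact_mod_cast Finset.sum_nonpos (sum_mul_nonpos_of_eq_zero hA hγ0 (i := i)
            (by simp [h])))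
      · rw [hγsplit]
        linarith [hvn i, hdom' i (lt_of_le_of_ne (hβv i) h)]
    have hqγ := hprop (castQ (v - β)) p (by simp [castQ, hp])
    have hterm : ∀ i ∈ Finset.univ, castQ (v - β) i *
        bf (gram d A) (Pi.single i 1) (castQ (v - β)) ≤ 0 := fun i _ =>
      mul_nonpos_of_nonneg_of_nonpos (by simpa [castQ] using hβv i) (hγn i)
    rw [bf_eq_sum_single] at hqγ
    have hz := (Finset.sum_eq_zero_iff_of_nonpos hterm).mp
      (le_antisymm (Finset.sum_nonpos hterm) hqγ)
    have hz1 : ∀ i, β i ≠ v i → bf (gram d A) (Pi.single i 1) (castQ (v - β)) = 0 := by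
      intro i hi
      refine (mul_eq_zero.mp (hz i (Finset.mem_univ _))).resolve_left fun h => hi ?_
      have : ((v i - β i : ℤ) : ℚ) = 0 := h
      have : v i - β i = 0 := by exact_mod_cast this
      omega
    have hz2 : ∀ i, β i ≠ v i → bf (gram d A) (Pi.single i 1) (castQ β) = 0 := by
      intro i hi
      have h1 := hz1 i hi
      rw [hγsplit] at h1
      linarith [hvn i, hdom' i (lt_of_le_of_ne (hβv i) hi)]
    have hγβ : bf (gram d A) (castQ (v - β)) (castQ β) = 0 := by
      rw [bf_eq_sum_single]
      refine Finset.sum_eq_zero fun i _ => ?_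
      rcases eq_or_ne (β i) (v i) with h | h
      · simp [castQ, h]
      · rw [hz2 i h, mul_zero]
    rw [bf_symm hsym, bf_eq_sum_single] at hγβ
    obtain ⟨a, ha, b, hb, hab⟩ := hInd {i | β i = v i} ⟨p, hp⟩ ⟨l, hl⟩
    have ha : β a = v a := ha
    have hb : β b ≠ v b := hb
    have h1 : bf (gram d A) (Pi.single a 1) (castQ (v - β)) < 0 := by
      rw [bf_gram_single]
      refine mul_neg_of_pos_of_neg (hd a) ?_
      exact_mod_cast sum_mul_neg_of_eq_zero hA hγ0 (by simp [ha]) hab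
        (by simpa using sub_ne_zero.mpr hb.symm)
    refine (Finset.sum_neg' (s := Finset.univ) (fun i _ => ?_)
      ⟨a, Finset.mem_univ _, ?_⟩).ne hγβ
    · exact mul_nonpos_of_nonneg_of_nonpos (by simpa [castQ] using hβ0 i) (hγn i)
    · exact mul_neg_of_pos_of_neg (by simpa [castQ] using hβpos a) h1
  · push Not at hP
    have h1 : 0 ≤ bf (gram d A) (castQ v) (castQ β) := by
      rw [bf_eq_sum_single]
      exact Finset.sum_nonneg fun i _ => mul_nonneg (by simpa [castQ] using (hv0 i).le)
        (hdom' i (lt_of_le_of_ne (hβv i) (hP i)))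
    have h2 : bf (gram d A) (castQ β) (castQ v) < 0 := by
      rw [bf_eq_sum_single]
      exact Finset.sum_neg' (fun i _ => mul_nonpos_of_nonneg_of_nonpos
        (by simpa [castQ] using hβ0 i) (hvn i))
        ⟨k, Finset.mem_univ _, mul_neg_of_pos_of_neg (by simpa [castQ] using hβpos k) hk⟩
    rw [bf_symm hsym] at h2
    linarith

/-- Nonnegative integral vectors of negative norm are roots. -/
lemma wtSp_ne_bot_of_bf_neg (hA : IsGCM A) (hInd : Indecomposable A) {d : I → ℚ}
    (hd : ∀ i, 0 < d i) (hsym : ∀ i j, d i * (A i j : ℚ) = d j * (A j i : ℚ))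
    (hprop : ∀ x : I → ℚ, ∀ i₀, x i₀ = 0 → 0 ≤ bf (gram d A) x x) {v : I → ℤ}
    (hv0 : ∀ i, 0 ≤ v i) (hv : bf (gram d A) (castQ v) (castQ v) < 0) :
    G.wtSp (G.wt v) ≠ ⊥ := by
  have hoff : ∀ i j, i ≠ j → gram d A i j ≤ 0 := fun i j hij =>
    mul_nonpos_of_nonneg_of_nonpos (hd i).le (by exact_mod_cast hA.2.1 i j hij)
  induction hN : (∑ i, v i).toNat using Nat.strong_induction_on generalizing v with
  | _ N ih =>
  have hvpos : ∀ i, 0 < v i := fun i => lt_of_le_of_ne (hv0 i) fun h =>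
    (hprop (castQ v) i (by simp [castQ, ← h])).not_gt hv
  by_cases hanti : ∀ i, ∑ j, A i j * v j ≤ 0
  · exact wtSp_ne_bot_of_antidominant hA hInd hd hsym hprop hvpos hv hanti
  push Not at hanti
  obtain ⟨i, hi⟩ := hanti
  obtain ⟨n, hn⟩ : ∃ n : ℤ, n = ∑ j, A i j * v j := ⟨_, rfl⟩
  rw [← hn] at hi
  set v' : I → ℤ := v + (-n) • Pi.single i 1 with hv'
  have hcast : castQ v' = castQ v + (-(n : ℚ)) • Pi.single i 1 := by
    rw [hv', castQ_add, castQ_smul, castQ_single]; push_cast; rfl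
  have hq : bf (gram d A) (castQ v') (castQ v') = bf (gram d A) (castQ v) (castQ v) := by
    rw [hcast, bf_add_smul_self (M := gram d A) hsym,
      bf_symm (M := gram d A) hsym (castQ v) (Pi.single i 1),
      bf_gram_single,
      bf_single_single, ← hn, gram, hA.1]
    push_cast
    ring
  have hv'i : v' i = v i - n := by simp [hv']; ring
  have hv'j : ∀ j, j ≠ i → v' j = v j := fun j hj => by simp [hv', hj]
  have hv'0 : ∀ j, 0 ≤ v' j := by
    rcases sign_of_bf_neg hsym hoff hprop (hq.trans_lt hv) with h | h
    · intro j
      have : (0 : ℚ) < (v' j : ℚ) := h j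
      exact_mod_cast this.le
    · exfalso
      have hone : ∀ j, j = i := by
        intro j
        by_contra hj
        have h1 : (v' j : ℚ) < 0 := h j
        rw [hv'j j hj] at h1
        have h2 : v j < 0 := by exact_mod_cast h1
        exact (hv0 j).not_gt h2
      refine hv.not_ge ?_
      rw [bf_eq_sum_single]
      refine Finset.sum_nonneg fun j _ => ?_
      rw [hone j, bf_gram_single, ← hn]
      exact mul_nonneg (by simpa [castQ] using hv0 i)
        (mul_nonneg (hd i).le (by exact_mod_cast hi.le))
  have hsum : ∑ j, v' j = ∑ j, v j - n := by
    simp [hv', Finset.sum_add_distrib, Pi.single_apply]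
    ring
  have hs0 : 0 ≤ ∑ j, v' j := Finset.sum_nonneg fun j _ => hv'0 j
  have h1 := ih (∑ j, v' j).toNat (by omega) hv'0 (hq.trans_lt hv) rfl
  have h2 := wtSp_add_smul_root_ne_bot hA h1 i n.toNat (by
    rw [wt_coroot]
    have h3 : ∑ j, A i j * v' j = -(n.toNat : ℤ) := by
      rw [Int.toNat_of_nonneg hi.le]
      simp [hv', mul_add, Finset.sum_add_distrib, Pi.single_apply, ← hn, hA.1]
      ring
    rw [h3]; push_cast; rfl) n.toNat le_rfl
  convert h2 using 3
  rw [← wt_single, ← map_nsmul, ← map_add]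
  congr 1
  rw [hv', add_assoc, ← natCast_zsmul, Int.toNat_of_nonneg hi.le, neg_smul, neg_add_cancel,
    add_zero]

end KacMoodyAlgebra

end ImaginaryRoots

section InvariantPairing

instance prodLieRingModule {L M N : Type*} [LieRing L] [AddCommGroup M] [AddCommGroup N]
    [LieRingModule L M] [LieRingModule L N] : LieRingModule L (M × N) where
  bracket x p := (⁅x, p.1⁆, ⁅x, p.2⁆)
  add_lie x y p := Prod.ext (add_lie x y p.1) (add_lie x y p.2)
  lie_add x p q := Prod.ext (lie_add x p.1 q.1) (lie_add x p.2 q.2)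
  leibniz_lie x y p := Prod.ext (leibniz_lie x y p.1) (leibniz_lie x y p.2)

instance prodLieModule {R L M N : Type*} [CommRing R] [LieRing L] [LieAlgebra R L]
    [AddCommGroup M] [AddCommGroup N] [Module R M] [Module R N] [LieRingModule L M]
    [LieRingModule L N] [LieModule R L M] [LieModule R L N] : LieModule R L (M × N) where
  smul_lie c x p := Prod.ext (smul_lie c x p.1) (smul_lie c x p.2)
  lie_smul c x p := Prod.ext (lie_smul c x p.1) (lie_smul c x p.2)

lemma exists_dual_family {V J : Type*} [AddCommGroup V] [Module ℂ V] [DecidableEq J]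
    {v : J → V} (hv : LinearIndependent ℂ v) :
    ∃ ψ : J → Module.Dual ℂ V, ∀ i j, ψ i (v j) = if i = j then 1 else 0 := by
  obtain ⟨π, hπ⟩ := LinearMap.exists_leftInverse_of_injective
    (Finsupp.linearCombination ℂ v) (LinearMap.ker_eq_bot.mpr hv)
  refine ⟨fun i => Finsupp.lapply i ∘ₗ π, fun i j => ?_⟩
  have := LinearMap.congr_fun hπ (Finsupp.single j 1)
  simp only [LinearMap.comp_apply, Finsupp.linearCombination_single, one_smul,
    LinearMap.id_apply] at this
  rw [LinearMap.comp_apply, this, Finsupp.lapply_apply, Finsupp.single_apply]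
  simp only [eq_comm]

/-- A linearly independent family of linear forms takes arbitrary values. -/
lemma exists_forall_apply_eq {V J : Type*} [AddCommGroup V] [Module ℂ V] [DecidableEq J]
    [FiniteDimensional ℂ V] {ℓ : J → Module.Dual ℂ V} (hℓ : LinearIndependent ℂ ℓ) :
    ∃ x : J → V, ∀ i j, ℓ j (x i) = if i = j then 1 else 0 := by
  obtain ⟨ψ, hψ⟩ := exists_dual_family hℓ
  refine ⟨fun i => (Module.evalEquiv ℂ V).symm (ψ i), fun i j => ?_⟩
  rw [Module.apply_evalEquiv_symm_apply, hψ]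

lemma exists_symm_form {V J : Type*} [AddCommGroup V] [Module ℂ V] [Fintype J] [DecidableEq J]
    {v : J → V} (hv : LinearIndependent ℂ v) {ℓ : J → Module.Dual ℂ V}
    (hℓ : ∀ i j, ℓ i (v j) = ℓ j (v i)) :
    ∃ β : V →ₗ[ℂ] V →ₗ[ℂ] ℂ, (∀ x y, β x y = β y x) ∧ ∀ i y, β (v i) y = ℓ i y := by
  obtain ⟨ψ, hψ⟩ := exists_dual_family hv
  obtain ⟨β, hβ⟩ : ∃ β : V →ₗ[ℂ] V →ₗ[ℂ] ℂ, ∀ x y, β x y =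
      ∑ i, ψ i x * ℓ i y + ∑ i, ψ i y * ℓ i x - ∑ i, ∑ j, ℓ i (v j) * (ψ i x * ψ j y) :=
    ⟨∑ i, (ψ i).smulRight (ℓ i) + ∑ i, (ℓ i).smulRight (ψ i) -
      ∑ i, ∑ j, ℓ i (v j) • (ψ i).smulRight (ψ j), fun x y => by
        simp [LinearMap.sum_apply, mul_comm]⟩
  refine ⟨β, fun x y => ?_, fun i y => ?_⟩
  · rw [hβ, hβ, Finset.sum_comm (f := fun i j => ℓ i (v j) * (ψ i x * ψ j y)),
      add_comm (∑ i, ψ i x * ℓ i y)]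
    simp only [fun i j => hℓ j i, mul_comm (ψ _ x) (ψ _ y)]
  · rw [hβ]
    simp [hψ, hℓ i, mul_comm]

variable {I : Type*} [Fintype I] [DecidableEq I] {A : Matrix I I ℤ}
variable {g : Type*} [LieRing g] [LieAlgebra ℂ g]

namespace KacMoodyAlgebra

variable {G : KacMoodyAlgebra A g}

variable (G) in
lemma exists_cartan_proj : ∃ p : g →ₗ[ℂ] G.H, (∀ h : G.H, p h = h) ∧
    ∀ χ ≠ 0, ∀ x ∈ G.wtSp χ, p x = 0 := by
  have hc : IsCompl G.H (⨆ χ ∈ {χ | χ ≠ 0}, G.wtSp χ) := by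
    refine ⟨?_, codisjoint_iff.mpr (eq_top_iff.mpr ?_)⟩
    · have := G.iSupIndep_wtSp.disjoint_biSup (x := 0) (y := {χ | χ ≠ 0}) (by simp)
      rwa [wtSp, G.zero_weight] at this
    · rw [← G.weight_decomp]
      refine iSup_le fun χ => ?_
      rcases eq_or_ne χ 0 with rfl | h
      · rw [G.zero_weight]; exact le_sup_left
      · exact le_sup_of_le_right (le_biSup G.wtSp h)
  refine ⟨Submodule.projectionOnto _ _ hc, fun h => ?_, fun χ hχ x hx => ?_⟩
  · exact Submodule.projectionOnto_apply_left hc h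
  · rw [Submodule.projectionOnto_apply_eq_zero_iff]
    exact (le_biSup G.wtSp (show χ ∈ {χ | χ ≠ 0} from hχ)) hx

lemma wtSp_induction {P : g → Prop} (hP : ∀ χ, ∀ x ∈ G.wtSp χ, P x) (h0 : P 0)
    (hadd : ∀ x y, P x → P y → P (x + y)) (x : g) : P x :=
  Submodule.iSup_induction G.wtSp (motive := P) (by rw [G.weight_decomp]; trivial) hP h0 hadd

/-- The obstruction to symmetry of a relation between `g` and its dual. -/
def pairSkew (g : Type*) [LieRing g] [LieAlgebra ℂ g] :
    (g × Module.Dual ℂ g) →ₗ[ℂ] (g × Module.Dual ℂ g) →ₗ[ℂ] ℂ :=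
  LinearMap.mk₂ ℂ (fun p q => p.2 q.1 - q.2 p.1)
    (fun p p' q => by simp; ring) (fun c p q => by simp; ring)
    (fun p q q' => by simp; ring) (fun c p q => by simp; ring)

lemma pairSkew_apply (p q : g × Module.Dual ℂ g) : pairSkew g p q = p.2 q.1 - q.2 p.1 := rfl

lemma pairSkew_lie (z : g) (p q : g × Module.Dual ℂ g) :
    pairSkew g ⁅z, p⁆ q = -pairSkew g p ⁅z, q⁆ := by
  change -p.2 ⁅z, q.1⁆ - q.2 ⁅z, p.1⁆ = -(p.2 ⁅z, q.1⁆ - -q.2 ⁅z, p.1⁆)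
  ring

lemma pairSkew_swap (p q : g × Module.Dual ℂ g) : pairSkew g p q = -pairSkew g q p := by
  rw [pairSkew_apply, pairSkew_apply]; ring

section

variable {W : Type*} [AddCommGroup W] [Module ℂ W] [LieRingModule g W] [LieModule ℂ g W]

lemma lie_eq_smul_of_mem_tower {J : Type*} {a : J → g} {V0 : Submodule ℂ W} {h : g} {ε : ℂ}
    (ha : ∀ i, ⁅h, a i⁆ = ε • a i) (h0 : ∀ w ∈ V0, ⁅h, w⁆ = 0) (n : ℕ) {w : W}
    (hw : w ∈ tower a V0 n) : ⁅h, w⁆ = (n * ε) • w := by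
  induction n generalizing w with
  | zero => simpa using h0 w hw
  | succ n ih =>
    have := tower_succ_le (a := a) (V0 := V0) (n := n)
      (U := LinearMap.ker (LieModule.toEnd ℂ g W h - ((n + 1 : ℕ) * ε) • LinearMap.id))
      (fun i w hw => by
        rw [LinearMap.mem_ker, LinearMap.sub_apply, LieModule.toEnd_apply_apply, leibniz_lie,
          ha, ih hw, LinearMap.smul_apply, LinearMap.id_apply, smul_lie, lie_smul, ← add_smul,
          sub_eq_zero]
        congr 1
        push_cast
        ring) hw
    rwa [LinearMap.mem_ker, LinearMap.sub_apply, sub_eq_zero] at this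

end

lemma pairSkew_eq_zero_of_degree {p q : g × Module.Dual ℂ g} {h : g} {a b : ℂ}
    (hp : ⁅h, p⁆ = a • p) (hq : ⁅h, q⁆ = b • q) (hab : a + b ≠ 0) : pairSkew g p q = 0 := by
  have h1 := pairSkew_lie h p q
  rw [hp, hq, map_smul, map_smul, LinearMap.smul_apply, smul_eq_mul, smul_eq_mul] at h1
  have h2 : (a + b) * pairSkew g p q = 0 := by linear_combination h1
  exact (mul_eq_zero.mp h2).resolve_left hab

/-- A relation generated by a symmetric one is symmetric. -/
lemma pairSkew_eq_zero_of_mem_hull {V0 : Submodule ℂ (g × Module.Dual ℂ g)} (hV : Seed G V0)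
    (hH : ∀ h : G.H, ∀ w ∈ V0, ⁅(h : g), w⁆ = 0) (h0 : ∀ p ∈ V0, ∀ q ∈ V0, pairSkew g p q = 0)
    {p q : g × Module.Dual ℂ g} (hp : p ∈ hull G V0) (hq : q ∈ hull G V0) :
    pairSkew g p q = 0 := by
  have := G.findimH
  obtain ⟨x, hx⟩ := exists_forall_apply_eq G.indepRoot
  have hx1 : ∀ i, G.root i (∑ j, x j) = 1 := fun i => by simp [hx]
  have he : ∀ i, ⁅((∑ j, x j : G.H) : g), G.e i⁆ = (1 : ℂ) • G.e i := fun i => by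
    rw [G.lie_e, hx1]
  have hf : ∀ i, ⁅((∑ j, x j : G.H) : g), G.f i⁆ = (-1 : ℂ) • G.f i := fun i => by
    rw [G.lie_f, hx1]
  have hee : ∀ m n, ∀ p ∈ tower G.e V0 m, ∀ q ∈ tower G.e V0 n, pairSkew g p q = 0 := by
    intro m n p hp q hq
    by_cases hmn : m + n = 0
    · obtain ⟨rfl, rfl⟩ : m = 0 ∧ n = 0 := by omega
      exact h0 p hp q hq
    · refine pairSkew_eq_zero_of_degree (lie_eq_smul_of_mem_tower he (hH _) m hp)
        (lie_eq_smul_of_mem_tower he (hH _) n hq) ?_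
      rw [mul_one, mul_one]
      exact_mod_cast hmn
  have hff : ∀ m n, ∀ p ∈ tower G.f V0 m, ∀ q ∈ tower G.f V0 n, pairSkew g p q = 0 := by
    intro m n p hp q hq
    by_cases hmn : m + n = 0
    · obtain ⟨rfl, rfl⟩ : m = 0 ∧ n = 0 := by omega
      exact h0 p hp q hq
    · refine pairSkew_eq_zero_of_degree (lie_eq_smul_of_mem_tower hf (hH _) m hp)
        (lie_eq_smul_of_mem_tower hf (hH _) n hq) ?_
      rw [← add_mul]
      exact mul_ne_zero (by exact_mod_cast hmn) (by norm_num)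
  have hef : ∀ m n, ∀ p ∈ tower G.e V0 m, ∀ q ∈ tower G.f V0 n, pairSkew g p q = 0 := by
    intro m n p hp q hq
    rcases eq_or_ne m n with rfl | hmn
    · induction m generalizing p q with
      | zero => exact h0 p hp q hq
      | succ m ih =>
        refine (tower_succ_le (a := G.e) (V0 := V0) (n := m)
          (U := LinearMap.ker ((pairSkew g).flip q)) fun i w hw => ?_) hp
        rw [LinearMap.mem_ker, LinearMap.flip_apply, pairSkew_lie, neg_eq_zero]
        exact ih w hw _ (hV.e_mem m i hq)
    · refine pairSkew_eq_zero_of_degree (lie_eq_smul_of_mem_tower he (hH _) m hp)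
        (lie_eq_smul_of_mem_tower hf (hH _) n hq) ?_
      rw [mul_one, mul_neg_one, ← sub_eq_add_neg, sub_ne_zero]
      exact_mod_cast hmn
  have hfe : ∀ m n, ∀ p ∈ tower G.f V0 m, ∀ q ∈ tower G.e V0 n, pairSkew g p q = 0 := by
    intro m n p hp q hq
    rw [pairSkew_swap, hef n m q hq p hp, neg_zero]
  have hright : ∀ p, (∀ n, ∀ q ∈ tower G.e V0 n, pairSkew g p q = 0) →
      (∀ n, ∀ q ∈ tower G.f V0 n, pairSkew g p q = 0) → pairSkew g p q = 0 :=
    fun p h1 h2 => (hull_le (U := LinearMap.ker (pairSkew g p)) h1 h2) hq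
  exact (hull_le (U := LinearMap.ker ((pairSkew g).flip q))
    (fun m p hp => hright p (fun n => hee m n p hp) fun n => hef m n p hp)
    (fun m p hp => hright p (fun n => hfe m n p hp) fun n => hff m n p hp)) hp

end KacMoodyAlgebra

end InvariantPairing

section CartanSeed

variable {I : Type*} [Fintype I] [DecidableEq I] {A : Matrix I I ℤ}
variable {g : Type*} [LieRing g] [LieAlgebra ℂ g]

namespace KacMoodyAlgebra

variable {G : KacMoodyAlgebra A g}

/-- The graph of the map from the Cartan subalgebra to the dual given by a form `β` and
a projection `p`. -/
def cartanGraph (p : g →ₗ[ℂ] G.H) (β : G.H →ₗ[ℂ] G.H →ₗ[ℂ] ℂ) :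
    G.H →ₗ[ℂ] g × Module.Dual ℂ g :=
  G.H.subtype.prod (p.dualMap ∘ₗ β)

variable {p : g →ₗ[ℂ] G.H} {β : G.H →ₗ[ℂ] G.H →ₗ[ℂ] ℂ}

lemma lie_H_cartanGraph (hp0 : ∀ χ ≠ 0, ∀ x ∈ G.wtSp χ, p x = 0) (h k : G.H) :
    ⁅(h : g), cartanGraph p β k⁆ = 0 := by
  refine Prod.ext (G.abelian h k) (LinearMap.ext fun y => ?_)
  change -β k (p ⁅(h : g), y⁆) = 0
  induction y using wtSp_induction (G := G) with
  | hP χ x hx =>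
    rw [(G.mem_wtSp).mp hx h, map_smul]
    rcases eq_or_ne χ 0 with rfl | hχ
    · simp
    · simp [hp0 χ hχ x hx]
  | h0 => simp
  | hadd x y h1 h2 => rw [lie_add, map_add, map_add, neg_add, h1, h2, add_zero]

lemma wtSp_root_sub_eq_bot (hA : IsGCM A) {i j : I} (hij : i ≠ j) :
    G.wtSp (G.root i - G.root j) = ⊥ := by
  by_contra h
  rw [← wt_single, ← wt_single, ← map_sub] at h
  rcases sign_of_wtSp_ne_bot hA h with h | h
  · have := h j
    simp [hij] at this
  · have := h i
    simp [hij.symm] at this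

/-- The common part of the two stability conditions in `seed_cartanGraph`. -/
lemma form_proj_lie_lie (hA : IsGCM A) {d : I → ℚ}
    (hp : ∀ h : G.H, p h = h) (hp0 : ∀ χ ≠ 0, ∀ x ∈ G.wtSp χ, p x = 0)
    (hβ : ∀ x y, β x y = β y x) (hβc : ∀ i y, β (G.coroot i) y = G.root i y / (d i : ℂ))
    {a b : I → g} (ε : ℂ) (hε : ε * ε = 1)
    (ha : ∀ i, a i ∈ G.wtSp (ε • G.root i)) (hb : ∀ i, b i ∈ G.wtSp (-(ε • G.root i)))
    (hab : ∀ i j, ⁅a i, b j⁆ = if j = i then ε • (G.coroot i : g) else 0) (i j : I) (h : G.H)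
    (y : g) : β h (p ⁅b i, ⁅a j, y⁆⁆) =
      if i = j then G.root i h * β (G.coroot i) (p y) else 0 := by
  induction y using wtSp_induction (G := G) with
  | hP χ x hx =>
    rcases eq_or_ne χ 0 with rfl | hχ
    · obtain ⟨x, rfl⟩ : ∃ z : G.H, (z : g) = x := ⟨⟨x, G.mem_wtSp_zero.mp hx⟩, rfl⟩
      rw [← lie_skew (a j), (G.mem_wtSp).mp (ha j) x, lie_neg, lie_smul, ← lie_skew (b i), smul_neg,
        neg_neg, hab, hp, hβc, LinearMap.smul_apply, smul_eq_mul]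
      split_ifs with hij
      · subst hij
        rw [smul_smul, map_smul, hp, map_smul, hβ, hβc, smul_eq_mul]
        linear_combination (G.root i x * (G.root i h / d i)) * hε
      · simp
    · rw [hp0 χ hχ x hx, map_zero, mul_zero, ite_self]
      have h1 := lie_mem_wtSpaceι (hb i) (lie_mem_wtSpaceι (ha j) hx)
      rcases eq_or_ne (-(ε • G.root i) + (ε • G.root j + χ)) 0 with h2 | h2
      · have h3 : χ = ε • (G.root i - G.root j) := by
          rw [smul_sub, sub_eq_neg_add, ← sub_eq_zero, ← h2]; abel
        have hij : i ≠ j := fun h => hχ (by rw [h3, h, sub_self, smul_zero])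
        have h4 : G.wtSp χ = ⊥ := by
          rcases mul_self_eq_one_iff.mp hε with rfl | rfl
          · rw [h3, one_smul, wtSp_root_sub_eq_bot hA hij]
          · rw [h3, neg_one_smul, neg_sub, wtSp_root_sub_eq_bot hA hij.symm]
        rw [h4, Submodule.mem_bot] at hx
        simp [hx]
      · rw [hp0 _ h2 _ h1, map_zero]
  | h0 => simp
  | hadd x y h1 h2 =>
    rw [lie_add, lie_add, map_add, map_add, h1, h2, map_add, map_add]
    split_ifs
    · ring
    · simp

lemma seed_cartanGraph (hA : IsGCM A) {d : I → ℚ}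
    (hp : ∀ h : G.H, p h = h) (hp0 : ∀ χ ≠ 0, ∀ x ∈ G.wtSp χ, p x = 0)
    (hβ : ∀ x y, β x y = β y x) (hβc : ∀ i y, β (G.coroot i) y = G.root i y / (d i : ℂ)) :
    Seed G (LinearMap.range (cartanGraph p β)) := by
  have key : ∀ (i j : I) (h : G.H) (w : g × Module.Dual ℂ g),
      w.1 = (if i = j then G.root i h • (G.coroot i : g) else 0) →
      (∀ y, w.2 y = if i = j then G.root i h * β (G.coroot i) (p y) else 0) →
      w ∈ LinearMap.range (cartanGraph p β) := by
    intro i j h w h1 h2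
    refine ⟨if i = j then G.root i h • G.coroot i else 0, ?_⟩
    refine Prod.ext ?_ (LinearMap.ext fun y => ?_)
    · rw [h1]
      change ((if i = j then G.root i h • G.coroot i else 0 : G.H) : g) = _
      split_ifs <;> rfl
    · rw [h2]
      change β (if i = j then G.root i h • G.coroot i else 0) (p y) = _
      split_ifs <;> simp
  refine ⟨?_, ?_, ?_⟩
  · rintro h _ ⟨k, rfl⟩
    rw [lie_H_cartanGraph hp0]
    exact zero_mem _
  · rintro i j _ ⟨h, rfl⟩
    refine key i j h _ ?_ fun y => ?_
    · change ⁅G.f j, ⁅G.e i, (h : g)⁆⁆ = _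
      rw [lie_e_H i h.2, lie_smul, ← lie_skew, G.e_f, Subtype.coe_eta]
      split_ifs with h1 h2 h2
      · simp
      · exact absurd h1.symm h2
      · exact absurd h2.symm h1
      · simp
    · change - -β h (p ⁅G.e i, ⁅G.f j, y⁆⁆) = _
      rw [neg_neg]
      refine form_proj_lie_lie hA hp hp0 hβ hβc (-1) (by norm_num) (a := G.f) (b := G.e)
        (fun i => by simpa using G.f_mem i) (fun i => by simpa using G.e_mem i)
        (fun i j => ?_) i j h y
      rw [← lie_skew, G.e_f]
      split_ifs with h1 h2 h2
      · subst h1; simp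
      · exact absurd h1.symm h2
      · exact absurd h2.symm h1
      · simp
  · rintro i j _ ⟨h, rfl⟩
    refine key i j h _ ?_ fun y => ?_
    · change ⁅G.e j, ⁅G.f i, (h : g)⁆⁆ = _
      rw [lie_f_H i h.2, lie_smul, G.e_f, Subtype.coe_eta]
      split_ifs with h1
      · subst h1; rfl
      · simp
    · change - -β h (p ⁅G.f i, ⁅G.e j, y⁆⁆) = _
      rw [neg_neg]
      exact form_proj_lie_lie hA hp hp0 hβ hβc 1 (by norm_num) (a := G.e) (b := G.f)
        (fun i => by simpa using G.e_mem i) (fun i => by simpa using G.f_mem i)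
        (fun i j => by simpa using G.e_f i j) i j h y

/-- A bracket `⁅x, y⁆` in the Cartan subalgebra represents, via the invariant form, a multiple of
the weight of `x`. -/
lemma exists_pairing_coeffs (hA : IsGCM A) {d : I → ℚ} (hd : ∀ i, 0 < d i)
    (hsym : ∀ i j, d i * (A i j : ℚ) = d j * (A j i : ℚ)) {x y : g} {k : G.H}
    (hxy : ⁅x, y⁆ = k) : ∃ (u : I → ℂ) (c : ℂ),
      (k = ∑ i, (u i * (d i : ℂ)) • G.coroot i) ∧
      ∀ (h : G.H) (a : ℂ), ⁅(h : g), x⁆ = a • x → ∑ i, u i * G.root i h = a * c := by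
  have hdC : ∀ i, ((d i : ℚ) : ℂ) ≠ 0 := fun i => by exact_mod_cast (hd i).ne'
  have hsymC : ∀ i j, (d i : ℂ) * (A i j : ℂ) = d j * (A j i : ℂ) := fun i j => by
    exact_mod_cast hsym i j
  obtain ⟨p, hp, hp0⟩ := G.exists_cartan_proj
  obtain ⟨β, hβ, hβc⟩ := exists_symm_form G.indepCoroot
    (ℓ := fun i => (d i : ℂ)⁻¹ • G.root i) (fun i j => by
      simp only [LinearMap.smul_apply, G.pairing, smul_eq_mul]
      have := hsymC i j
      have := hdC i
      have := hdC j
      field_simp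
      linear_combination -hsymC i j)
  replace hβc : ∀ i y, β (G.coroot i) y = G.root i y / (d i : ℂ) := fun i y => by
    rw [hβc, LinearMap.smul_apply, smul_eq_mul, div_eq_inv_mul]
  set V0 := LinearMap.range (cartanGraph p β) with hV0
  have hV : Seed G V0 := seed_cartanGraph hA hp hp0 hβ hβc
  have hmem : ∀ h, cartanGraph p β h ∈ hull G V0 := fun h =>
    le_hull (LinearMap.mem_range_self _ h)
  have hskew : ∀ q ∈ hull G V0, ∀ r ∈ hull G V0, pairSkew g q r = 0 := by
    intro q hq r hr
    refine pairSkew_eq_zero_of_mem_hull hV ?_ ?_ hq hr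
    · rintro h _ ⟨z, rfl⟩
      exact lie_H_cartanGraph hp0 h z
    · rintro _ ⟨z, rfl⟩ _ ⟨w, rfl⟩
      change β z (p w) - β w (p z) = 0
      rw [hp, hp, hβ, sub_self]
  have hex : ∀ z : g, ∃ Θ : Module.Dual ℂ g, (z, Θ) ∈ hull G V0 := by
    let K : LieSubalgebra ℂ g :=
      { (hull G V0).map (LinearMap.fst ℂ g (Module.Dual ℂ g)) with
        lie_mem' := by
          rintro a _ - ⟨w, hw, rfl⟩
          exact ⟨⁅a, w⁆, hV.lie_mem_hull a hw, rfl⟩ }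
    have hK : ∀ a : g, ∀ z ∈ K, ⁅a, z⁆ ∈ K := by
      rintro a _ ⟨w, hw, rfl⟩
      exact ⟨⁅a, w⁆, hV.lie_mem_hull a hw, rfl⟩
    have hKH : ∀ h : G.H, (h : g) ∈ K := fun h => ⟨_, hmem h, rfl⟩
    intro z
    obtain ⟨w, hw, rfl⟩ : z ∈ K := by
      refine mem_of_generators (G := G) hKH (fun i => ?_) (fun i => ?_) z
      · have h1 := hK (G.e i) _ (hKH (G.coroot i))
        rw [lie_e_H i (G.coroot i).2, Subtype.coe_eta, G.pairing, hA.1] at h1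
        have h2 := K.smul_mem (-(1 / 2) : ℂ) h1
        rw [smul_smul] at h2
        norm_num at h2
        exact h2
      · have h1 := hK (G.f i) _ (hKH (G.coroot i))
        rw [lie_f_H i (G.coroot i).2, Subtype.coe_eta, G.pairing, hA.1] at h1
        have h2 := K.smul_mem ((1 / 2) : ℂ) h1
        rw [smul_smul] at h2
        norm_num at h2
        exact h2
    exact ⟨w.2, hw⟩
  obtain ⟨Θ, hΘ⟩ := hex y
  obtain ⟨c, hc⟩ := exists_coroot_coeffs hA hxy
  refine ⟨fun i => c i / d i, Θ x, ?_, fun h a ha => ?_⟩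
  · rw [hc]
    exact Finset.sum_congr rfl fun i _ => by rw [div_mul_cancel₀ _ (hdC i)]
  · have h1 := sub_mem (hV.lie_mem_hull x hΘ) (hmem k)
    have h2 : -Θ ⁅x, (h : g)⁆ - β k (p h) = 0 := by
      obtain ⟨Ψ, hΨ⟩ := hex h
      have h3 := hskew _ h1 _ hΨ
      rw [pairSkew_apply] at h3
      have h4 : (⁅x, (y, Θ)⁆ - cartanGraph p β k).1 = 0 := by
        change ⁅x, y⁆ - (k : g) = 0
        rw [hxy, sub_self]
      rw [h4, map_zero, sub_zero] at h3
      exact h3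
    rw [← lie_skew, ha, map_neg, map_smul, neg_neg, hp, smul_eq_mul, sub_eq_zero] at h2
    rw [h2, hc]
    simp [map_sum, LinearMap.sum_apply, hβc, div_mul_eq_mul_div, mul_div_assoc]

end KacMoodyAlgebra

end CartanSeed

section GradingData

variable {I : Type*} [Fintype I] [DecidableEq I] {A : Matrix I I ℤ}
variable {g : Type*} [LieRing g] [LieAlgebra ℂ g]
variable {S : Type*} [Fintype S] [DecidableEq S] {B : Matrix S S ℤ}
variable {m : Type*} [LieRing m] [LieAlgebra ℂ m]

open KacMoodyAlgebra

lemma KacMoodyAlgebra.wt_apply_apply (G : KacMoodyAlgebra A g) (v : I → ℤ) (h : G.H) :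
    G.wt v h = ∑ i, (v i : ℂ) * G.root i h := by
  simp [wt_apply]

section

variable {G : KacMoodyAlgebra A g} {M : KacMoodyAlgebra B m} {φ : m →ₗ⁅ℂ⁆ g}

lemma wtSp_le_restricted (hle : M.H.map φ.toLinearMap ≤ G.H) (χ : Module.Dual ℂ G.H) :
    G.wtSp χ ≤ wtSpaceι (φ.toLinearMap ∘ₗ M.H.subtype) (resD G M φ hle χ) :=
  fun _ hx v => hx (cartanIncl G M φ hle v)

lemma iSupIndep_restricted : iSupIndep (wtSpaceι (φ.toLinearMap ∘ₗ M.H.subtype)) :=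
  iSupIndep_wtSpaceι fun v w => by
    change ⁅φ (v : m), φ (w : m)⁆ = 0
    rw [← LieHom.map_lie, M.abelian, map_zero]

lemma exists_resD_eq_wt (hB : IsGCM B) (hgr : IsFinGrading M φ)
    (hle : M.H.map φ.toLinearMap ≤ G.H) {χ : Module.Dual ℂ G.H} (hχ : G.wtSp χ ≠ ⊥) :
    ∃ w : S → ℤ, resD G M φ hle χ = M.wt w ∧ ((∀ s, 0 ≤ w s) ∨ ∀ s, w s ≤ 0) := by
  have h1 : wtSpaceι (φ.toLinearMap ∘ₗ M.H.subtype) (resD G M φ hle χ) ≠ ⊥ := fun h =>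
    hχ (le_bot_iff.mp (h ▸ wtSp_le_restricted hle χ))
  rcases iSupIndep_restricted.mem_of_biSup_eq_top hgr.2.1 h1 with h | h
  · exact ⟨0, by simpa using h, .inl fun _ => le_rfl⟩
  · exact exists_wt_of_ne_bot hB h.2

lemma resD_wt (hle : M.H.map φ.toLinearMap ≤ G.H) {D : S → I → ℤ}
    (hD : ∀ i, resRoot G M φ hle i = M.wt fun s => D s i) (v : I → ℤ) :
    resD G M φ hle (G.wt v) = M.wt fun s => ∑ i, v i * D s i := by
  have h1 : resD G M φ hle (G.wt v) = ∑ i, v i • resRoot G M φ hle i := by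
    refine LinearMap.ext fun x => ?_
    change G.wt v (cartanIncl G M φ hle x) = _
    rw [wt_apply_apply, LinearMap.sum_apply]
    refine Finset.sum_congr rfl fun i _ => ?_
    rw [LinearMap.smul_apply, zsmul_eq_mul]
    rfl
  rw [h1]
  simp only [hD, ← map_zsmul, ← map_sum]
  congr 1
  ext s
  simp

lemma exists_not_root_of_restriction_zero (hgr : IsFinGrading M φ)
    (hle : M.H.map φ.toLinearMap ≤ G.H) {v : I → ℤ} (hv : v ≠ 0)
    (hv0 : resD G M φ hle (G.wt v) = 0) : ∃ k : ℕ, G.wtSp (G.wt ((k + 1) • v)) = ⊥ := by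
  by_contra! h
  choose x hx hx0 using fun k => (Submodule.ne_bot_iff _).mp (h k)
  have h1 : LinearIndependent ℂ x := by
    refine (G.iSupIndep_wtSp.comp (f := fun k : ℕ => G.wt ((k + 1) • v)) ?_).linearIndependent _
      hx hx0
    intro a b hab
    obtain ⟨i, hi⟩ := Function.ne_iff.mp hv
    have h2 := congrFun (G.wt_injective hab) i
    simp only [Pi.smul_apply, nsmul_eq_mul, Pi.zero_apply] at h2 hi
    have := mul_right_cancel₀ hi h2
    push_cast at this
    omega
  set V := wtSpaceι (φ.toLinearMap ∘ₗ M.H.subtype) (0 : Module.Dual ℂ M.H)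
  have : FiniteDimensional ℂ V := hgr.2.2 0 (Set.mem_insert _ _)
  have hxV : ∀ k, x k ∈ V := fun k => by
    have h3 := wtSp_le_restricted hle _ (hx k)
    have h4 : resD G M φ hle (G.wt ((k + 1) • v)) = 0 := by
      rw [map_nsmul]
      change (k + 1) • resD G M φ hle (G.wt v) = 0
      rw [hv0, smul_zero]
    rwa [h4] at h3
  have h5 : LinearIndependent ℂ fun k => (⟨x k, hxV k⟩ : V) :=
    LinearIndependent.of_comp V.subtype h1
  exact not_finite_iff_infinite.mpr (inferInstanceAs (Infinite ℕ)) h5.finite_of_isNoetherian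

lemma lie_cartanIncl_e (hle : M.H.map φ.toLinearMap ≤ G.H) (h : M.H) (s : S) :
    ⁅(cartanIncl G M φ hle h : g), φ (M.e s)⁆ = M.root s h • φ (M.e s) := by
  change ⁅φ (h : m), φ (M.e s)⁆ = _
  rw [← LieHom.map_lie, M.lie_e, map_smul]

lemma exists_rat_retraction : ∃ τ : ℂ →ₗ[ℚ] ℚ, τ 1 = 1 := by
  obtain ⟨τ, hτ⟩ := LinearMap.exists_leftInverse_of_injective (Algebra.linearMap ℚ ℂ)
    (LinearMap.ker_eq_bot.mpr (algebraMap ℚ ℂ).injective)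
  exact ⟨τ, by simpa using LinearMap.congr_fun hτ 1⟩

/-- The rational linear algebra underlying a finite grading. -/
lemma exists_grading_data (hA : IsGCM A) {d : I → ℚ} (hd : ∀ i, 0 < d i)
    (hsym : ∀ i j, d i * (A i j : ℚ) = d j * (A j i : ℚ)) (hB : IsGCM B)
    (hgr : IsFinGrading M φ) (hle : M.H.map φ.toLinearMap ≤ G.H) :
    ∃ (D : S → I → ℤ) (u : S → I → ℚ) (c : S → ℚ),
      (∀ v, G.wtSp (G.wt v) ≠ ⊥ →
        (∀ s, 0 ≤ ∑ i, v i * D s i) ∨ ∀ s, ∑ i, v i * D s i ≤ 0) ∧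
      (∀ v ≠ 0, (∀ s, ∑ i, v i * D s i = 0) → ∃ k : ℕ, G.wtSp (G.wt ((k + 1) • v)) = ⊥) ∧
      (∀ x : S → ℚ, (∀ i, ∑ s, x s * D s i = 0) → x = 0) ∧
      (∀ s j, bf (gram d A) (u s) (Pi.single j 1) = ∑ t, (B s t : ℚ) * D t j) ∧
      ∀ s t, ∑ i, u s i * D t i = if s = t then c s else 0 := by
  choose D' hD' _ using fun i => exists_resD_eq_wt hB hgr hle (G := G)
    (χ := G.root i) (by rw [← wt_single]; exact G.wtSp_single_ne_bot hA i)
  let D : S → I → ℤ := fun s i => D' i s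
  have hD : ∀ i, resRoot G M φ hle i = M.wt fun s => D s i := hD'
  have hDr : ∀ i h, G.root i (cartanIncl G M φ hle h) = ∑ s, (D s i : ℂ) * M.root s h :=
    fun i h => by rw [← wt_apply_apply, ← hD]; rfl
  have := M.findimH
  obtain ⟨δ, hδ⟩ := exists_forall_apply_eq M.indepRoot
  have hDδ : ∀ i t, G.root i (cartanIncl G M φ hle (δ t)) = D t i := fun i t => by
    simp [hDr, hδ]
  have hlie : ∀ s, ⁅φ (M.e s), φ (M.f s)⁆ = (cartanIncl G M φ hle (M.coroot s) : g) := fun s => by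
    rw [← LieHom.map_lie, M.e_f, if_pos rfl]; rfl
  choose u c hk hu using fun s => exists_pairing_coeffs hA hd hsym (hlie s)
  obtain ⟨τ, hτ⟩ := exists_rat_retraction
  have hτm : ∀ (q : ℚ) z, τ (z * (q : ℂ)) = τ z * q := fun q z => by
    have := τ.map_smul q z
    rw [Rat.smul_def, smul_eq_mul] at this
    rw [mul_comm z, this, mul_comm]
  have hτ' : ∀ q : ℚ, τ (q : ℂ) = q := fun q => by
    have := hτm q 1
    rwa [one_mul, hτ, one_mul] at this
  have hτz : ∀ n : ℤ, τ (n : ℂ) = n := fun n => by simpa using hτ' n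
  have hτmz : ∀ (n : ℤ) z, τ (z * (n : ℂ)) = τ z * n := fun n z => by simpa using hτm n z
  refine ⟨D, fun s i => τ (u s i), fun s => τ (c s), fun v hv => ?_, fun v hv h0 => ?_,
    fun x hx => ?_, fun s j => ?_, fun s t => ?_⟩
  · obtain ⟨w, hw, h⟩ := exists_resD_eq_wt hB hgr hle hv
    rw [resD_wt hle hD] at hw
    rw [← M.wt_injective hw] at h
    exact h
  · refine exists_not_root_of_restriction_zero hgr hle hv ?_
    rw [resD_wt hle hD]
    simp only [h0]
    exact map_zero M.wt
  · have h1 : ∀ i, G.root i (cartanIncl G M φ hle (∑ t, (x t : ℂ) • δ t)) = 0 := fun i => by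
      rw [map_sum, map_sum]
      simp only [map_smul, hDδ, smul_eq_mul]
      exact_mod_cast hx i
    ext s
    have h2 := lie_eq_zero_of_root_eq_zero h1 (φ (M.e s))
    rw [lie_cartanIncl_e, smul_eq_zero] at h2
    rcases h2 with h2 | h2
    · simpa [hδ] using h2
    · exact absurd (hgr.1 (h2.trans (map_zero φ).symm)) (M.isSl2Triple hB s).e_ne_zero
  · have h1 := congrArg (G.root j) (hk s)
    simp only [hDr, map_sum, map_smul, G.pairing, M.pairing, smul_eq_mul] at h1
    have h2 := congrArg τ h1
    rw [map_sum, map_sum] at h2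
    have h3 : ∀ t, τ ((D t j : ℂ) * (B s t : ℂ)) = B s t * D t j := fun t => by
      rw [← Int.cast_mul, hτz, mul_comm, Int.cast_mul]
    have h4 : ∀ i, τ (u s i * d i * (A i j : ℂ)) = τ (u s i) * (d i * A i j) := fun i => by
      rw [hτmz, hτm, mul_assoc]
    simp only [h3, h4] at h2
    rw [h2, bf_apply]
    simp [gram, Pi.single_apply]
  · have h1 := congrArg τ (hu s _ _ (lie_cartanIncl_e hle (δ t) s))
    simp only [hDδ, hδ, map_sum, hτmz] at h1
    rw [h1]
    rcases eq_or_ne t s with rfl | h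
    · simp
    · simp [h, h.symm]

end

end GradingData

section Conclusion

open Filter Topology

lemma exists_pos_perturbation {a b c a' b' : ℚ} (h : a < 0 ∨ a = 0 ∧ b < 0) (h' : 0 < a') :
    ∃ ε : ℚ, 0 < ε ∧ a + 2 * ε * b + ε ^ 2 * c < 0 ∧ 0 < a' + ε * b' := by
  have h1 : ∀ᶠ ε : ℚ in 𝓝[>] 0, a + 2 * ε * b + ε ^ 2 * c < 0 := by
    rcases h with h | ⟨rfl, h⟩
    · have : Continuous fun ε : ℚ => a + 2 * ε * b + ε ^ 2 * c := by fun_prop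
      exact nhdsWithin_le_nhds (this.continuousAt.eventually_lt_const (by simpa using h))
    · have : Continuous fun ε : ℚ => 2 * b + ε * c := by fun_prop
      have h2 : ∀ᶠ ε : ℚ in 𝓝[>] 0, 2 * b + ε * c < 0 :=
        nhdsWithin_le_nhds (this.continuousAt.eventually_lt_const (by simp; linarith))
      filter_upwards [h2, self_mem_nhdsWithin] with ε hε hε0
      have := mul_neg_of_pos_of_neg hε0 hε
      linarith
  have h2 : ∀ᶠ ε : ℚ in 𝓝[>] 0, 0 < a' + ε * b' := by
    have : Continuous fun ε : ℚ => a' + ε * b' := by fun_prop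
    exact nhdsWithin_le_nhds (this.continuousAt.eventually_const_lt (by simpa using h'))
  obtain ⟨ε, ⟨h3, h4⟩, h5⟩ := ((h1.and h2).and self_mem_nhdsWithin).exists
  exact ⟨ε, h5, h3, h4⟩

variable {I : Type*} [Fintype I]

lemma exists_castQ_eq_smul (w : I → ℚ) : ∃ (N : ℕ) (z : I → ℤ), 0 < N ∧ castQ z = (N : ℚ) • w := by
  refine ⟨∏ i, (w i).den, fun i => (w i).num * ∏ j ∈ Finset.univ.erase i, ((w j).den : ℤ),
    Finset.prod_pos fun i _ => (w i).pos, ?_⟩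
  ext i
  rw [← Finset.mul_prod_erase _ _ (Finset.mem_univ i)]
  simp only [castQ, Pi.smul_apply, smul_eq_mul]
  push_cast
  rw [mul_right_comm, mul_comm _ (w i), Rat.mul_den_eq_num]

variable {S : Type*} {A : Matrix I I ℤ} {d : I → ℚ} {R : (I → ℤ) → Prop} {D : S → I → ℤ}

lemma dotProduct_castQ (v : I → ℤ) (s : S) :
    castQ v ⬝ᵥ castQ (D s) = ((∑ i, v i * D s i : ℤ) : ℚ) := by
  simp [dotProduct, castQ]

lemma dotProduct_signs_of_bf_neg (hM : ∀ i j, gram d A i j = gram d A j i)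
    (hoff : ∀ i j, i ≠ j → gram d A i j ≤ 0)
    (hprop : ∀ x : I → ℚ, ∀ i₀, x i₀ = 0 → 0 ≤ bf (gram d A) x x)
    (hR : ∀ v, (∀ i, 0 ≤ v i) → bf (gram d A) (castQ v) (castQ v) < 0 → R v)
    (h1 : ∀ v, R v → (∀ s, 0 ≤ ∑ i, v i * D s i) ∨ ∀ s, ∑ i, v i * D s i ≤ 0)
    (h2 : ∀ v ≠ 0, (∀ s, ∑ i, v i * D s i = 0) → ∃ k : ℕ, ¬ R ((k + 1) • v))
    {w : I → ℚ} (hw : bf (gram d A) w w < 0) :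
    ((∀ s, 0 ≤ w ⬝ᵥ castQ (D s)) ∨ ∀ s, w ⬝ᵥ castQ (D s) ≤ 0) ∧
      ∃ s, w ⬝ᵥ castQ (D s) ≠ 0 := by
  wlog hw0 : ∀ i, 0 < w i generalizing w
  · have h3 := (sign_of_bf_neg hM hoff hprop hw).resolve_left hw0
    obtain ⟨h4, s, h5⟩ := this (w := -w) (by simpa using hw) fun i => by simpa using h3 i
    simp only [neg_dotProduct, Left.nonneg_neg_iff, Left.neg_nonpos_iff, ne_eq, neg_eq_zero]
      at h4 h5
    exact ⟨h4.symm, s, h5⟩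
  obtain ⟨N, z, hN, hz⟩ := exists_castQ_eq_smul w
  have hN' : (0 : ℚ) < N := by exact_mod_cast hN
  have hz0 : ∀ i, 0 ≤ z i := fun i => by
    have h3 := congrFun hz i
    have h4 : (0 : ℚ) ≤ z i := by
      change (z i : ℚ) = N * w i at h3
      rw [h3]
      exact (mul_pos hN' (hw0 i)).le
    exact_mod_cast h4
  have hzs : ∀ s, ((∑ i, z i * D s i : ℤ) : ℚ) = N * (w ⬝ᵥ castQ (D s)) := fun s => by
    rw [← dotProduct_castQ, hz, smul_dotProduct, smul_eq_mul]
  have hneg : ∀ k : ℕ, R ((k + 1) • z) := fun k => by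
    refine hR _ (fun i => nsmul_nonneg (hz0 i) _) ?_
    have h3 : castQ ((k + 1) • z) = ((k + 1) * N : ℚ) • w := by
      rw [mul_smul, ← hz]
      ext i
      simp [castQ]
    rw [h3, bf_smul_self]
    exact mul_neg_of_pos_of_neg (by positivity) hw
  constructor
  · refine (h1 z (by simpa using hneg 0)).imp (fun h s => ?_) fun h s => ?_
    · have h3 : (0 : ℚ) ≤ N * (w ⬝ᵥ castQ (D s)) := by rw [← hzs]; exact_mod_cast h s
      exact nonneg_of_mul_nonneg_right h3 hN'
    · have h3 : N * (w ⬝ᵥ castQ (D s)) ≤ 0 := by rw [← hzs]; exact_mod_cast h s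
      exact nonpos_of_mul_nonpos_right h3 hN'
  · by_contra! h
    have hzne : z ≠ 0 := by
      rintro rfl
      have h3 : w = 0 := by
        have : (N : ℚ) • w = 0 := by rw [← hz]; ext; simp [castQ]
        exact (smul_eq_zero.mp this).resolve_left hN'.ne'
      simp [h3] at hw
    obtain ⟨k, hk⟩ := h2 z hzne fun s => by
      have := hzs s
      rw [h s, mul_zero] at this
      exact_mod_cast this
    exact hk (hneg k)

/-- Vectors of negative length are not orthogonal to any restricted simple direction. -/
lemma dotProduct_ne_zero_of_bf_neg [DecidableEq I] (hM : ∀ i j, gram d A i j = gram d A j i)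
    (hsgn : ∀ w : I → ℚ, bf (gram d A) w w < 0 →
      ((∀ s, 0 ≤ w ⬝ᵥ castQ (D s)) ∨ ∀ s, w ⬝ᵥ castQ (D s) ≤ 0) ∧ ∃ s, w ⬝ᵥ castQ (D s) ≠ 0)
    (hD : ∀ t, D t ≠ 0) {v : I → ℚ} (hv : bf (gram d A) v v < 0) (t : S) :
    v ⬝ᵥ castQ (D t) ≠ 0 := by
  intro ht
  obtain ⟨s, hs⟩ := (hsgn v hv).2
  obtain ⟨i, hi⟩ := Function.ne_iff.mp (hD t)
  have hi : (D t i : ℚ) ≠ 0 := by exact_mod_cast hi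
  set α := v ⬝ᵥ castQ (D s)
  set w : I → ℚ := (-α * D t i) • Pi.single i 1 with hw
  have hwt : w ⬝ᵥ castQ (D t) = -α * (D t i) ^ 2 := by
    rw [hw, smul_dotProduct, single_dotProduct, smul_eq_mul]
    simp only [castQ]
    ring
  obtain ⟨ε, hε, h1, h2⟩ := exists_pos_perturbation (b := bf (gram d A) v w)
    (c := bf (gram d A) w w) (b' := α * (w ⬝ᵥ castQ (D s))) (.inl hv)
    (mul_self_pos.mpr hs)
  rw [← bf_add_smul_self (M := gram d A) hM] at h1
  have h3 : 0 ≤ ((v + ε • w) ⬝ᵥ castQ (D s)) * ((v + ε • w) ⬝ᵥ castQ (D t)) := by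
    rcases (hsgn _ h1).1 with h | h
    · exact mul_nonneg (h s) (h t)
    · exact mul_nonneg_of_nonpos_of_nonpos (h s) (h t)
  simp only [add_dotProduct, smul_dotProduct, smul_eq_mul, ht, hwt, zero_add] at h3
  have h4 : 0 < ε * (D t i : ℚ) ^ 2 := by positivity
  have h5 := mul_pos h4 h2
  change 0 ≤ (α + ε * (w ⬝ᵥ castQ (D s))) * (ε * (-α * (D t i : ℚ) ^ 2)) at h3
  linarith

variable [Fintype S] {B : Matrix S S ℤ} {u : S → I → ℚ} {c : S → ℚ}

lemma bf_eq_sum_dotProduct [DecidableEq I] (hM : ∀ i j, gram d A i j = gram d A j i)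
    (h4 : ∀ s j, bf (gram d A) (u s) (Pi.single j 1) = ∑ t, (B s t : ℚ) * D t j) (s : S)
    (w : I → ℚ) : bf (gram d A) (u s) w = ∑ t, (B s t : ℚ) * (w ⬝ᵥ castQ (D t)) := by
  rw [bf_symm (M := gram d A) hM, bf_eq_sum_single]
  simp only [dotProduct, castQ, Finset.mul_sum]
  rw [Finset.sum_comm]
  refine Finset.sum_congr rfl fun i _ => ?_
  rw [bf_symm (M := gram d A) hM, h4, Finset.mul_sum]
  exact Finset.sum_congr rfl fun t _ => by ring

lemma bf_dual_eq [DecidableEq I] [DecidableEq S] (hM : ∀ i j, gram d A i j = gram d A j i)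
    (h4 : ∀ s j, bf (gram d A) (u s) (Pi.single j 1) = ∑ t, (B s t : ℚ) * D t j)
    (h5 : ∀ s t, u s ⬝ᵥ castQ (D t) = if s = t then c s else 0) (s t : S) :
    bf (gram d A) (u s) (u t) = B s t * c t := by
  rw [bf_eq_sum_dotProduct hM h4]
  simp [h5]

lemma coeff_ne_zero [DecidableEq I] [DecidableEq S] (hBind : Indecomposable B)
    (hM : ∀ i j, gram d A i j = gram d A j i)
    (hTL : ∀ v, bf (gram d A) v v < 0 → ∀ t, v ⬝ᵥ castQ (D t) ≠ 0) (hD : ∀ t, D t ≠ 0)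
    (h3 : ∀ x : S → ℚ, (∀ i, ∑ s, x s * D s i = 0) → x = 0)
    (h4 : ∀ s j, bf (gram d A) (u s) (Pi.single j 1) = ∑ t, (B s t : ℚ) * D t j)
    (h5 : ∀ s t, u s ⬝ᵥ castQ (D t) = if s = t then c s else 0) {s t : S} (hst : t ≠ s) :
    c s ≠ 0 := by
  intro hc
  have hus : u s ⬝ᵥ castQ (D s) = 0 := by simp [h5, hc]
  have hq : bf (gram d A) (u s) (u s) = 0 := by rw [bf_dual_eq hM h4 h5, hc, mul_zero]
  have hker : ∀ w, w ⬝ᵥ castQ (D s) = 0 → bf (gram d A) (u s) w = 0 := by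
    intro w hw
    by_contra hne
    wlog hneg : bf (gram d A) (u s) w < 0 generalizing w
    · refine this (-w) (by simp [hw]) (by simpa using hne) ?_
      rw [map_neg]
      exact neg_neg_of_pos (lt_of_le_of_ne (not_lt.mp hneg) (Ne.symm hne))
    obtain ⟨ε, -, h6, -⟩ := exists_pos_perturbation (c := bf (gram d A) w w) (b' := 0)
      (.inr ⟨hq, hneg⟩) one_pos
    rw [← bf_add_smul_self (M := gram d A) hM] at h6
    refine hTL _ h6 s ?_
    simp [add_dotProduct, smul_dotProduct, hus, hw]
  obtain ⟨i₀, hi₀⟩ := Function.ne_iff.mp (hD s)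
  have hi₀ : (D s i₀ : ℚ) ≠ 0 := by exact_mod_cast hi₀
  set n : I → ℚ := fun i => ∑ t, (B s t : ℚ) * D t i
  have h6 := h3 (fun t => D s i₀ * B s t - if t = s then n i₀ else 0) fun i => by
    have h7 := hker ((D s i₀ : ℚ) • Pi.single i 1 - (D s i : ℚ) • Pi.single i₀ 1) (by
      simp only [sub_dotProduct, smul_dotProduct, single_dotProduct, smul_eq_mul, castQ]
      ring)
    simp only [map_sub, map_smul, h4, smul_eq_mul] at h7
    simp only [sub_mul, Finset.sum_sub_distrib, ite_mul, zero_mul, Finset.sum_ite_eq',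
      Finset.mem_univ, if_true, mul_assoc, ← Finset.mul_sum]
    linarith
  obtain ⟨a, rfl, b, hb, hab⟩ := hBind {s} ⟨s, rfl⟩ ⟨t, hst⟩
  have h7 := congrFun h6 b
  rw [if_neg (Set.mem_compl_singleton_iff.mp hb), sub_zero] at h7
  exact hab (by exact_mod_cast (mul_eq_zero.mp h7).resolve_left hi₀)

lemma isHyperbolic_of_dual_family [DecidableEq I] [DecidableEq S] (hBgcm : IsGCM B)
    (hBind : Indecomposable B) (hM : ∀ i j, gram d A i j = gram d A j i)
    (hTL : ∀ v, bf (gram d A) v v < 0 → ∀ t, v ⬝ᵥ castQ (D t) ≠ 0) (hD : ∀ t, D t ≠ 0)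
    (h3 : ∀ x : S → ℚ, (∀ i, ∑ s, x s * D s i = 0) → x = 0)
    (h4 : ∀ s j, bf (gram d A) (u s) (Pi.single j 1) = ∑ t, (B s t : ℚ) * D t j)
    (h5 : ∀ s t, u s ⬝ᵥ castQ (D t) = if s = t then c s else 0) : IsHyperbolic B := by
  intro s₀ k hk
  have hbf := bf_dual_eq hM h4 h5
  have hBc : ∀ s t, (B s t : ℚ) * c t = B t s * c s := fun s t => by
    rw [← hbf, ← hbf, bf_symm (M := gram d A) hM]
  have hpsd : ∀ v, v ⬝ᵥ castQ (D s₀) = 0 → 0 ≤ bf (gram d A) v v := fun v hv =>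
    not_lt.mp fun h => hTL v h s₀ hv
  have hc : ∀ s, s ≠ s₀ → 0 < c s := fun s hs => by
    have h6 := hpsd (u s) (by simp [h5, hs])
    rw [hbf, hBgcm.1] at h6
    refine lt_of_le_of_ne ?_ (coeff_ne_zero hBind hM hTL hD h3 h4 h5 hs.symm).symm
    norm_num at h6
    exact h6
  have hK : ∀ s : cmpnt B {i | i ≠ s₀} k, 0 < c s := fun s => hc s s.2.1
  refine finite_or_affine_of_psd (d := fun s => (c s)⁻¹) (isGCM_restrictM hBgcm _)
    (indecomposable_restrictM_cmpnt hBgcm _ k) (fun s => inv_pos.mpr (hK s)) ?_ ?_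
  · intro s t
    have h6 := hBc s t
    have := (hK s).ne'
    have := (hK t).ne'
    simp only [restrictM]
    field_simp
    linarith
  · intro x
    have h6 := hpsd (∑ s : cmpnt B {i | i ≠ s₀} k, (x s * (c s)⁻¹) • u s) (by
      rw [sum_dotProduct]
      refine Finset.sum_eq_zero fun s _ => ?_
      rw [smul_dotProduct, h5, if_neg s.2.1, smul_zero])
    refine h6.trans_eq (Eq.trans ?_ (bf_apply _ _ _).symm)
    simp only [map_sum, LinearMap.sum_apply, map_smul, LinearMap.smul_apply, smul_eq_mul, hbf]
    refine Finset.sum_congr rfl fun s _ => ?_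
    rw [mul_assoc, Finset.mul_sum]
    refine congrArg (x s * ·) (Finset.sum_congr rfl fun t _ => ?_)
    have := (hK t).ne'
    rw [hBc]
    simp only [restrictM]
    field_simp

end Conclusion

end KMG


open KMG

section Statement

attribute [local instance] Classical.propDecidable

variable {I : Type*} [Fintype I] [DecidableEq I] {A : Matrix I I ℤ}
variable {g : Type*} [LieRing g] [LieAlgebra ℂ g]
variable {S : Type*} [Fintype S] [DecidableEq S] {B : Matrix S S ℤ}
variable {m : Type*} [LieRing m] [LieAlgebra ℂ m]

theorem statement14
    (hGCM : IsGCM A) (hInd : Indecomposable A) (hSym : Symmetrizable A)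
    (G : KacMoodyAlgebra A g)
    (hBgcm : IsGCM B) (hBind : Indecomposable B)
    (M : KacMoodyAlgebra B m) (φ : m →ₗ⁅ℂ⁆ g)
    (hgr : IsFinGrading M φ) (hle : M.H.map φ.toLinearMap ≤ G.H)
    (hhyp : IsHyperbolic A) :
    IsHyperbolic B := by
  obtain ⟨d, hd, hsym⟩ := exists_pos_symmetrizer hGCM hInd hSym
  obtain ⟨D, u, c, h1, h2, h3, h4, h5⟩ := exists_grading_data (G := G) hGCM hd hsym hBgcm hgr hle
  have hprop := bf_nonneg_of_hyperbolic hGCM hhyp hd hsym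
  have hD : ∀ t, D t ≠ 0 := fun t ht => by
    have := congrFun (h3 (Pi.single t 1) fun i => by simp [Pi.single_apply, ht]) t
    simp at this
  have hsgn := fun w => dotProduct_signs_of_bf_neg (w := w) hsym
    (fun i j hij => mul_nonpos_of_nonneg_of_nonpos (hd i).le
      (by exact_mod_cast hGCM.2.1 i j hij)) hprop
    (fun v hv0 hv => G.wtSp_ne_bot_of_bf_neg hGCM hInd hd hsym hprop hv0 hv) h1
    (fun v hv h => (h2 v hv h).imp fun _ hk => not_not_intro hk)
  exact isHyperbolic_of_dual_family hBgcm hBind hsym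
    (fun v hv t => dotProduct_ne_zero_of_bf_neg hsym hsgn hD hv t) hD h3 h4 h5

end Statement
end
end

section
/- Let g be an indecomposable symmetrizable Kac-Moody algebra which is maximally finitely Σ-graded with grading subalgebra m, and let ρ: I → Ī be the quotient map with ρ_a(α_k) = γ_{ρ(k)} and fibers Γ_s = ρ⁻¹({s}). Then: (1) if k≠l∈I and ρ(k)=ρ(l), there is no link between k and l in the Dynkin diagram of A, i.e. a_{k,l} = a_{l,k} = 0; (2) a ⊂ {h∈h : ⟨α_k,h⟩ = ⟨α_l,h⟩ whenever ρ(k)=ρ(l)}; (3) for suitable choices of the simple coroots and Chevalley generators of g and m, one has γ_s∨ = Σ_{k∈Γ_s} α_k∨, X̄_s = Σ_{k∈Γ_s} e_k and Ȳ_s = Σ_{k∈Γ_s} f_k; (4) consequently, for s,t∈Ī, ⟨γ_s, γ_t∨⟩ = Σ_{k∈Γ_t} ⟨α_i, α_k∨⟩ for any i∈Γ_s. -/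
attribute [local instance] Classical.propDecidable

noncomputable section

namespace KMG

section Words

variable {I : Type*} {g : Type*} [LieRing g] [LieAlgebra ℂ g]

/-- The iterated bracket `⁅x j₁, ⁅x j₂, … , x i⁆⁆` attached to a nonempty word. -/
def word (x : I → g) (i : I) : List I → g
  | [] => x i
  | j :: l => ⁅x j, word x i l⁆

/-- The span of all iterated brackets of a family. -/
def wordSpan (x : I → g) : Submodule ℂ g :=
  Submodule.span ℂ {y | ∃ i l, y = word x i l}

lemma word_mem_wordSpan (x : I → g) (i : I) (l : List I) : word x i l ∈ wordSpan x :=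
  Submodule.subset_span ⟨i, l, rfl⟩

end Words

section Triangular

variable {I : Type*} [Fintype I] [DecidableEq I] {A : Matrix I I ℤ}
variable {g : Type*} [LieRing g] [LieAlgebra ℂ g]

/-- The opposite Kac-Moody structure: the simple roots are replaced by their negatives and the
Chevalley generators `e i` and `f i` are exchanged. -/
def KacMoodyAlgebra.opp (G : KacMoodyAlgebra A g) : KacMoodyAlgebra A g where
  H := G.H
  root i := -G.root i
  coroot i := -G.coroot i
  e := G.f
  f := G.e
  findimH := G.findimH
  finrankH := G.finrankH
  indepRoot := by
    convert G.indepRoot.units_smul (fun _ => (-1 : ℂˣ)) using 2 with i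
    simp
  indepCoroot := by
    convert G.indepCoroot.units_smul (fun _ => (-1 : ℂˣ)) using 2 with i
    simp
  pairing i j := by simp [G.pairing]
  abelian := G.abelian
  lie_e x i := by simp [G.lie_f]
  lie_f x i := by simp [G.lie_e]
  e_f i j := by
    rw [← lie_skew, G.e_f]
    split_ifs with h₁ h₂ h₂
    · subst h₁; simp
    · exact absurd h₁.symm h₂
    · exact absurd h₂.symm h₁
    · simp
  serre_e := G.serre_f
  serre_f := G.serre_e
  generates := by
    rw [Set.union_right_comm]
    exact G.generates
  weight_decomp := G.weight_decomp
  zero_weight := G.zero_weight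

lemma lie_mem_of_mem_span {s : Set g} {T : Submodule ℂ g} {u t : g}
    (h : ∀ y ∈ s, ⁅u, y⁆ ∈ T) (ht : t ∈ Submodule.span ℂ s) : ⁅u, t⁆ ∈ T := by
  have : Submodule.span ℂ s ≤ T.comap (LieAlgebra.ad ℂ g u : g →ₗ[ℂ] g) :=
    Submodule.span_le.2 h
  exact this ht

lemma lie_word (G : KacMoodyAlgebra A g) (x : G.H) (i : I) (l : List I) :
    ⁅(x : g), word G.e i l⁆ = (G.root i x + (l.map fun j => G.root j x).sum) • word G.e i l := by
  induction l with
  | nil => simp [word, G.lie_e]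
  | cons j l ih =>
    rw [word, leibniz_lie, ih, G.lie_e, smul_lie, lie_smul, ← add_smul]
    congr 1
    simp only [List.map_cons, List.sum_cons]
    ring

lemma lie_f_word (G : KacMoodyAlgebra A g) (j i : I) (l : List I) :
    ⁅G.f j, word G.e i l⁆ ∈ wordSpan G.e ⊔ G.H := by
  have hef : ∀ k, ∃ x : G.H, ⁅G.f j, G.e k⁆ = (x : g) := fun k => by
    rw [← lie_skew, G.e_f]
    split_ifs with h
    · exact ⟨-G.coroot k, by simp⟩
    · exact ⟨0, by simp⟩
  induction l with
  | nil =>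
    obtain ⟨x, hx⟩ := hef i
    rw [word, hx]
    exact Submodule.mem_sup_right x.2
  | cons k l ih =>
    rw [word, leibniz_lie]
    refine add_mem ?_ ?_
    · obtain ⟨x, hx⟩ := hef k
      rw [hx, lie_word]
      exact Submodule.mem_sup_left (Submodule.smul_mem _ _ (word_mem_wordSpan _ _ _))
    · obtain ⟨y, hy, z, hz, hyz⟩ := Submodule.mem_sup.1 ih
      rw [← hyz, lie_add]
      refine Submodule.mem_sup_left (add_mem ?_ ?_)
      · refine lie_mem_of_mem_span ?_ hy
        rintro _ ⟨i', l', rfl⟩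
        exact word_mem_wordSpan G.e i' (k :: l')
      · rw [← lie_skew, G.lie_e ⟨z, hz⟩]
        exact neg_mem (Submodule.smul_mem _ _ (word_mem_wordSpan G.e k []))

lemma lie_wordSpan_mem (G : KacMoodyAlgebra A g) {u t : g}
    (hu : u ∈ (G.H : Set g) ∪ Set.range G.e ∪ Set.range G.f) (ht : t ∈ wordSpan G.e) :
    ⁅u, t⁆ ∈ wordSpan G.e ⊔ G.H := by
  refine lie_mem_of_mem_span ?_ ht
  rintro _ ⟨i, l, rfl⟩
  rcases hu with (hu | ⟨j, rfl⟩) | ⟨j, rfl⟩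
  · rw [lie_word G ⟨u, hu⟩]
    exact Submodule.mem_sup_left (Submodule.smul_mem _ _ (word_mem_wordSpan _ _ _))
  · exact Submodule.mem_sup_left (word_mem_wordSpan G.e i (j :: l))
  · exact lie_f_word G j i l

lemma eq_top_of_lieSpan_eq_top {s : Set g} (hs : LieSubalgebra.lieSpan ℂ g s = ⊤)
    {T : Submodule ℂ g} (hsT : s ⊆ T) (hT : ∀ u ∈ s, ∀ t ∈ T, ⁅u, t⁆ ∈ T) : T = ⊤ := by
  have key : ∀ x ∈ LieSubalgebra.lieSpan ℂ g s, x ∈ T ∧ ∀ t ∈ T, ⁅x, t⁆ ∈ T := by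
    intro x hx
    induction hx using LieSubalgebra.lieSpan_induction with
    | mem x h => exact ⟨hsT h, hT x h⟩
    | zero => exact ⟨zero_mem _, fun t _ => by simp⟩
    | add x y _ _ ihx ihy =>
      refine ⟨add_mem ihx.1 ihy.1, fun t ht => ?_⟩
      rw [add_lie]
      exact add_mem (ihx.2 t ht) (ihy.2 t ht)
    | smul a x _ ih =>
      refine ⟨T.smul_mem a ih.1, fun t ht => ?_⟩
      rw [smul_lie]
      exact T.smul_mem a (ih.2 t ht)
    | lie x y _ _ ihx ihy =>
      refine ⟨ihx.2 y ihy.1, fun t ht => ?_⟩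
      rw [lie_lie]
      exact sub_mem (ihx.2 _ (ihy.2 t ht)) (ihy.2 _ (ihx.2 t ht))
  exact Submodule.eq_top_iff'.2 fun x => (key x (hs ▸ LieSubalgebra.mem_top x)).1

/-- The triangular decomposition (without directness). -/
lemma triangular (G : KacMoodyAlgebra A g) : wordSpan G.e ⊔ wordSpan G.f ⊔ G.H = ⊤ := by
  have he : wordSpan G.e ≤ wordSpan G.e ⊔ wordSpan G.f ⊔ G.H := le_sup_left.trans le_sup_left
  have hf : wordSpan G.f ≤ wordSpan G.e ⊔ wordSpan G.f ⊔ G.H := le_sup_right.trans le_sup_left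
  have hH : G.H ≤ wordSpan G.e ⊔ wordSpan G.f ⊔ G.H := le_sup_right
  refine eq_top_of_lieSpan_eq_top G.generates ?_ ?_
  · rintro u ((hu | ⟨j, rfl⟩) | ⟨j, rfl⟩)
    · exact hH hu
    · exact he (word_mem_wordSpan G.e j [])
    · exact hf (word_mem_wordSpan G.f j [])
  · intro u hu t ht
    obtain ⟨y, hy, z, hz, rfl⟩ := Submodule.mem_sup.1 ht
    obtain ⟨y₁, hy₁, y₂, hy₂, rfl⟩ := Submodule.mem_sup.1 hy
    rw [lie_add, lie_add]
    refine add_mem (add_mem ?_ ?_) ?_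
    · exact sup_le he hH (lie_wordSpan_mem G hu hy₁)
    · rw [Set.union_right_comm] at hu
      exact sup_le hf hH (lie_wordSpan_mem G.opp hu hy₂)
    · rw [← lie_skew]
      refine neg_mem ?_
      rcases hu with (hu | ⟨j, rfl⟩) | ⟨j, rfl⟩
      · rw [G.abelian ⟨z, hz⟩ ⟨u, hu⟩]
        exact zero_mem _
      · rw [G.lie_e ⟨z, hz⟩]
        exact he (Submodule.smul_mem _ _ (word_mem_wordSpan G.e j []))
      · rw [G.lie_f ⟨z, hz⟩]
        exact hf (Submodule.smul_mem _ _ (word_mem_wordSpan G.f j []))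

lemma eigenspace_le_of_top_le {R V : Type*} [CommRing R] [IsDomain R] [AddCommGroup V]
    [Module R V] [Module.IsTorsionFree R V] (F : Module.End R V) (μ : R) {W : Submodule R V}
    (hW : W ≤ F.eigenspace μ) (hsup : ⊤ ≤ W ⊔ ⨆ ν, ⨆ _ : ν ≠ μ, F.eigenspace ν) :
    F.eigenspace μ ≤ W := by
  intro x hx
  obtain ⟨y, hy, z, hz, rfl⟩ := Submodule.mem_sup.1 (hsup (Submodule.mem_top (x := x)))
  have hz' : z ∈ F.eigenspace μ := by simpa using sub_mem hx (hW hy)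
  have := Submodule.disjoint_def.1 (F.eigenspaces_iSupIndep μ) z hz' hz
  simpa [this] using hy

/-- If `h` acts on the positive root vectors with positive integral degrees, then the part of
positive degree `n` is spanned by the iterated brackets of degree `n` of the `e i`. -/
lemma mem_span_words (G : KacMoodyAlgebra A g) (d : I → ℕ) (h : G.H)
    (hd : ∀ i, G.root i h = d i) {n : ℕ} (hn : n ≠ 0) {x : g} (hx : ⁅(h : g), x⁆ = (n : ℂ) • x) :
    x ∈ Submodule.span ℂ {y | ∃ i l, d i + (l.map d).sum = n ∧ y = word G.e i l} := by
  have he : ∀ i l, ⁅(h : g), word G.e i l⁆ = ((d i + (l.map d).sum : ℕ) : ℂ) • word G.e i l := by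
    intro i l
    rw [lie_word]
    simp only [hd]
    congr 1
    push_cast
    simp [List.map_map, Function.comp_def]
  have hf : ∀ i l,
      ⁅(h : g), word G.f i l⁆ = (-((d i + (l.map d).sum : ℕ) : ℂ)) • word G.f i l := by
    intro i l
    have hd' : ∀ i, G.opp.root i h = -(d i : ℂ) := fun i => by rw [← hd]; rfl
    refine (lie_word G.opp h i l).trans ?_
    simp only [hd']
    congr 1
    push_cast
    induction l with
    | nil => simp
    | cons j l ih =>
      simp only [List.map_cons, List.sum_cons] at ih ⊢
      linear_combination ih
  set F : Module.End ℂ g := LieAlgebra.ad ℂ g h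
  have hF : ∀ μ : ℂ, ∀ y, y ∈ F.eigenspace μ ↔ ⁅(h : g), y⁆ = μ • y := fun μ y => by
    rw [Module.End.mem_eigenspace_iff]; rfl
  refine eigenspace_le_of_top_le F (n : ℂ) ?_ ?_ ((hF _ _).2 hx)
  · rw [Submodule.span_le]
    rintro _ ⟨i, l, hil, rfl⟩
    refine (hF _ _).2 ?_
    rw [he, hil]
  · have hle : ∀ ν : ℂ, ν ≠ n → F.eigenspace ν ≤ ⨆ ν, ⨆ _ : ν ≠ (n : ℂ), F.eigenspace ν :=
      fun ν hν => le_iSup₂_of_le ν hν le_rfl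
    rw [← triangular G]
    refine sup_le (sup_le ?_ ?_) ?_
    · refine Submodule.span_le.2 ?_
      rintro _ ⟨i, l, rfl⟩
      by_cases hil : d i + (l.map d).sum = n
      · exact Submodule.mem_sup_left (Submodule.subset_span ⟨i, l, hil, rfl⟩)
      · exact Submodule.mem_sup_right
          (hle _ (by exact_mod_cast hil) ((hF _ _).2 (he i l)))
    · refine Submodule.span_le.2 ?_
      rintro _ ⟨i, l, rfl⟩
      refine Submodule.mem_sup_right (hle _ ?_ ((hF _ _).2 (hf i l)))
      intro hc
      have : ((d i + (l.map d).sum + n : ℕ) : ℂ) = 0 := by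
        push_cast at hc ⊢
        linear_combination -hc
      norm_cast at this
      omega
    · intro y hy
      refine Submodule.mem_sup_right (hle 0 (by exact_mod_cast hn.symm) ((hF _ _).2 ?_))
      rw [G.abelian h ⟨y, hy⟩, zero_smul]

/-- The degree `1` part when the `e i`, `i ∈ K`, have degree `1` and the others degree `3`. -/
lemma exists_sum_e_of_lie_eq (G : KacMoodyAlgebra A g) (K : I → Prop) [DecidablePred K] (h : G.H)
    (hd : ∀ i, G.root i h = if K i then 1 else 3) {x : g} (hx : ⁅(h : g), x⁆ = x) :
    ∃ c : I → ℂ, x = ∑ i, if K i then c i • G.e i else 0 := by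
  have hmem := mem_span_words G (fun i => if K i then 1 else 3) h
    (fun i => by rw [hd]; push_cast; rfl) one_ne_zero (x := x) (by simpa using hx)
  have hle : Submodule.span ℂ {y | ∃ i l, (if K i then 1 else 3) +
      (l.map fun i => if K i then 1 else 3).sum = 1 ∧ y = word G.e i l} ≤
      Submodule.span ℂ (Set.range fun i => if K i then G.e i else 0) := by
    refine Submodule.span_le.2 ?_
    rintro _ ⟨i, l, hil, rfl⟩
    refine Submodule.subset_span ⟨i, ?_⟩
    cases l with
    | nil =>
      by_cases hi : K i
      · simp [hi, word]
      · simp [hi] at hil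
    | cons j l =>
      simp only [List.map_cons, List.sum_cons] at hil
      split_ifs at hil <;> omega
  obtain ⟨c, hc⟩ := (Submodule.mem_span_range_iff_exists_fun ℂ).1 (hle hmem)
  refine ⟨c, hc.symm.trans (Finset.sum_congr rfl fun i _ => ?_)⟩
  split_ifs <;> simp

lemma exists_sum_f_of_lie_eq (G : KacMoodyAlgebra A g) (K : I → Prop) [DecidablePred K] (h : G.H)
    (hd : ∀ i, G.root i h = if K i then 1 else 3) {x : g} (hx : ⁅(h : g), x⁆ = -x) :
    ∃ c : I → ℂ, x = ∑ i, if K i then c i • G.f i else 0 := by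
  refine exists_sum_e_of_lie_eq G.opp K (-h : G.H) (fun i => ?_) ?_
  · rw [← hd i]
    change -(G.root i (-h)) = _
    rw [map_neg, neg_neg]
  · change ⁅((-h : G.H) : g), x⁆ = x
    simp [hx]

lemma eq_zero_of_lie_eq_two_smul (G : KacMoodyAlgebra A g) (s : I) (h : G.H)
    (hd : ∀ i, G.root i h = if i = s then 1 else 3) {x : g} (hx : ⁅(h : g), x⁆ = (2 : ℂ) • x) :
    x = 0 := by
  have hmem := mem_span_words G (fun i => if i = s then 1 else 3) h
    (fun i => by rw [hd]; push_cast; rfl) two_ne_zero (x := x) (by simpa using hx)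
  rw [← Submodule.mem_bot ℂ]
  refine (Submodule.span_le.2 ?_ : _ ≤ (⊥ : Submodule ℂ g)) hmem
  rintro _ ⟨i, l, hil, rfl⟩
  rw [SetLike.mem_coe, Submodule.mem_bot]
  rcases l with _ | ⟨j, _ | ⟨k, l⟩⟩
  · simp only [List.map_nil, List.sum_nil] at hil
    split_ifs at hil <;> omega
  · by_cases hi : i = s <;> by_cases hj : j = s <;> simp [hi, hj] at hil
    simp [word, hi, hj]
  · simp only [List.map_cons, List.sum_cons] at hil
    split_ifs at hil <;> omega

lemma KacMoodyAlgebra.exists_root_eq (G : KacMoodyAlgebra A g) (c : I → ℂ) :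
    ∃ h : G.H, ∀ i, G.root i h = c i := by
  have := G.findimH
  obtain ⟨F, hF⟩ := LinearMap.exists_leftInverse_of_injective
    (Finsupp.linearCombination ℂ G.root) (LinearMap.ker_eq_bot.2 G.indepRoot)
  refine ⟨(Module.evalEquiv ℂ G.H).symm (Finsupp.linearCombination ℂ c ∘ₗ F), fun i => ?_⟩
  rw [Module.apply_evalEquiv_symm_apply]
  have := LinearMap.congr_fun hF (Finsupp.single i 1)
  simp only [LinearMap.comp_apply, Finsupp.linearCombination_single, one_smul,
    LinearMap.id_apply] at this
  simp [this]

lemma KacMoodyAlgebra.e_ne_zero (G : KacMoodyAlgebra A g) (i : I) : G.e i ≠ 0 := by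
  intro h
  have := G.e_f i i
  rw [h, zero_lie, if_pos rfl] at this
  exact G.indepCoroot.ne_zero i (Subtype.ext this.symm)

lemma lie_e_e_ne_zero (G : KacMoodyAlgebra A g) {k l : I} (hkl : k ≠ l) (h : A l k ≠ 0) :
    ⁅G.e k, G.e l⁆ ≠ 0 := by
  intro h0
  have h1 : ⁅⁅G.e k, G.e l⁆, G.f l⁆ = (A l k : ℂ) • -G.e k := by
    rw [lie_lie, G.e_f, G.e_f, if_pos rfl, if_neg hkl.symm, lie_zero, sub_zero, ← lie_skew,
      G.lie_e, G.pairing, smul_neg]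
  rw [h0, zero_lie, eq_comm, smul_eq_zero] at h1
  rcases h1 with h1 | h1
  · exact h (by exact_mod_cast h1)
  · exact G.e_ne_zero k (neg_eq_zero.1 h1)

lemma isChevalleyGens_self (G : KacMoodyAlgebra A g) : IsChevalleyGens G G.e G.f :=
  ⟨G.lie_e, G.lie_f, G.e_f, G.serre_e, G.serre_f, G.generates⟩

lemma ad_smul_pow_smul_eq_zero {x y : g} {n : ℕ} (h : ((LieAlgebra.ad ℂ g x) ^ n) y = 0)
    (a b : ℂ) : ((LieAlgebra.ad ℂ g (a • x)) ^ n) (b • y) = 0 := by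
  rw [map_smul, map_smul (LieAlgebra.ad ℂ g), smul_pow, LinearMap.smul_apply, h, smul_zero, smul_zero]

lemma isChevalleyGens_smul (G : KacMoodyAlgebra A g) {c d : I → ℂ} (hcd : ∀ i, c i * d i = 1) :
    IsChevalleyGens G (fun i => c i • G.e i) (fun i => d i • G.f i) := by
  refine ⟨fun x i => ?_, fun x i => ?_, fun i j => ?_, fun i j hij => ?_, fun i j hij => ?_, ?_⟩
  · rw [lie_smul, G.lie_e, smul_comm]
  · rw [lie_smul, G.lie_f, smul_comm]
  · rw [smul_lie, lie_smul, G.e_f]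
    split_ifs with h
    · rw [h, smul_smul, hcd, one_smul]
    · simp
  · exact ad_smul_pow_smul_eq_zero (G.serre_e i j hij) _ _
  · exact ad_smul_pow_smul_eq_zero (G.serre_f i j hij) _ _
  · rw [eq_top_iff, ← G.generates, LieSubalgebra.lieSpan_le]
    rintro x ((hx | ⟨i, rfl⟩) | ⟨i, rfl⟩)
    · exact LieSubalgebra.subset_lieSpan (Or.inl (Or.inl hx))
    · have := LieSubalgebra.smul_mem (LieSubalgebra.lieSpan ℂ g ((G.H : Set g) ∪
        Set.range (fun i => c i • G.e i) ∪ Set.range (fun i => d i • G.f i))) (d i)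
        (LieSubalgebra.subset_lieSpan (Or.inl (Or.inr ⟨i, rfl⟩)))
      simpa [smul_smul, mul_comm (d i), hcd] using this
    · have := LieSubalgebra.smul_mem (LieSubalgebra.lieSpan ℂ g ((G.H : Set g) ∪
        Set.range (fun i => c i • G.e i) ∪ Set.range (fun i => d i • G.f i))) (c i)
        (LieSubalgebra.subset_lieSpan (Or.inr ⟨i, rfl⟩))
      simpa [smul_smul, hcd] using this

lemma finsum_mem_setOf_eq {α V : Type*} [Fintype α] [AddCommMonoid V] (p : α → Prop)
    [DecidablePred p] (f : α → V) : ∑ᶠ k ∈ {k | p k}, f k = ∑ k, if p k then f k else 0 := by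
  rw [finsum_eq_sum_of_fintype]
  exact Finset.sum_congr rfl fun k _ => finsum_eq_if

lemma lie_sum_e_sum_f (G : KacMoodyAlgebra A g) (p : I → Prop) [DecidablePred p] (c d : I → ℂ) :
    ⁅∑ i, (if p i then c i • G.e i else 0), ∑ i, if p i then d i • G.f i else 0⁆ =
      ((∑ i, if p i then (c i * d i) • G.coroot i else 0 : G.H) : g) := by
  rw [sum_lie, AddSubmonoidClass.coe_finsetSum]
  refine Finset.sum_congr rfl fun i _ => ?_
  rw [lie_sum, Finset.sum_eq_single i]
  · split_ifs
    · simp [G.e_f, smul_smul, mul_comm]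
    · simp
  · intro j _ hj
    split_ifs <;> simp [G.e_f, hj]
  · simp

end Triangular

end KMG

open KMG

section Statement

attribute [local instance] Classical.propDecidable

variable {I : Type*} [Fintype I] [DecidableEq I] {A : Matrix I I ℤ}
variable {g : Type*} [LieRing g] [LieAlgebra ℂ g]
variable {S : Type*} [Fintype S] [DecidableEq S] {B : Matrix S S ℤ}
variable {m : Type*} [LieRing m] [LieAlgebra ℂ m]

theorem statement16
    (hGCM : IsGCM A) (hInd : Indecomposable A) (hSym : Symmetrizable A)
    (G : KacMoodyAlgebra A g)
    (hBgcm : IsGCM B) (hBind : Indecomposable B)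
    (M : KacMoodyAlgebra B m) (φ : m →ₗ⁅ℂ⁆ g)
    (hgr : IsFinGrading M φ) (hle : M.H.map φ.toLinearMap ≤ G.H)
    (hadapt : Adapted G M φ hle)
    (hJ : Jof G M φ hle = ∅) (hIm : IpIm G M φ hle = ∅)
    (ρ : I → S) (hρ : ∀ k, resRoot G M φ hle k = M.root (ρ k)) :
    (∀ k l, k ≠ l → ρ k = ρ l → A k l = 0 ∧ A l k = 0) ∧
    (∀ (x : ↥M.H) (k l : I), ρ k = ρ l →
        G.root k (cartanIncl G M φ hle x) = G.root l (cartanIncl G M φ hle x)) ∧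
    (∃ e' f' : I → g, IsChevalleyGens G e' f' ∧
      ∃ X Y : S → m, IsChevalleyGens M X Y ∧
        (∀ s, φ ((M.coroot s : ↥M.H) : m) =
            ∑ᶠ k ∈ {k | ρ k = s}, ((G.coroot k : ↥G.H) : g)) ∧
        (∀ s, φ (X s) = ∑ᶠ k ∈ {k | ρ k = s}, e' k) ∧
        (∀ s, φ (Y s) = ∑ᶠ k ∈ {k | ρ k = s}, f' k)) ∧
    (∀ s t : S, ∀ i, ρ i = s →
        (B t s : ℂ) = ∑ᶠ k ∈ {k | ρ k = t}, (A k i : ℂ)) := by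
  classical
  have hroot : ∀ (x : M.H) k, G.root k (cartanIncl G M φ hle x) = M.root (ρ k) x :=
    fun x k => LinearMap.congr_fun (hρ k) x
  have hdisj : ∀ k l, k ≠ l → ρ k = ρ l → A l k = 0 := by
    intro k l hkl hρkl
    by_contra hA
    obtain ⟨v, hv⟩ := M.exists_root_eq (fun t => if t = ρ l then 1 else 3)
    have hres : resD G M φ hle (G.root k + G.root l) = (2 : ℂ) • M.root (ρ l) := by
      have h1 : resD G M φ hle (G.root k + G.root l) =
          resRoot G M φ hle k + resRoot G M φ hle l := LinearMap.add_comp _ _ _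
      rw [h1, hρ, hρ, hρkl, two_smul]
    have hne : (2 : ℂ) • M.root (ρ l) ≠ 0 :=
      smul_ne_zero two_ne_zero (M.indepRoot.ne_zero (ρ l))
    have hpos : G.root k + G.root l ∈ posRoots G := by
      refine ⟨⟨?_, ?_⟩, Pi.single k 1 + Pi.single l 1, ?_⟩
      · intro h0
        rw [h0] at hres
        exact hne (hres.symm.trans (LinearMap.zero_comp _))
      · refine (Submodule.ne_bot_iff _).2 ⟨⁅G.e k, G.e l⁆, fun x => ?_, lie_e_e_ne_zero G hkl hA⟩
        change ⁅(x : g), ⁅G.e k, G.e l⁆⁆ = _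
        rw [leibniz_lie, G.lie_e, G.lie_e, smul_lie, lie_smul, ← add_smul, LinearMap.add_apply]
      · simp [add_smul, Finset.sum_add_distrib, Pi.single_apply]
    rcases hadapt _ hpos with h | ⟨⟨-, h⟩, -⟩
    · exact hne (hres ▸ h)
    · obtain ⟨x, hx, hx0⟩ := (Submodule.ne_bot_iff _).1 h
      refine hx0 (eq_zero_of_lie_eq_two_smul M (ρ l) v (by simpa using hv) ?_)
      have := hx v
      rw [hres] at this
      simpa [hv] using this
  have hcoeff : ∀ s, ∃ c d : I → ℂ,
      (φ (M.e s) = ∑ k, if ρ k = s then c k • G.e k else 0) ∧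
      (φ (M.f s) = ∑ k, if ρ k = s then d k • G.f k else 0) ∧
      ∀ k, ρ k = s → c k * d k = 1 := by
    intro s
    obtain ⟨v, hv⟩ := M.exists_root_eq (fun t => if t = s then 1 else 3)
    have hd : ∀ k, G.root k (cartanIncl G M φ hle v) = if ρ k = s then 1 else 3 := fun k => by
      rw [hroot, hv]
    obtain ⟨c, hc⟩ := exists_sum_e_of_lie_eq G (fun k => ρ k = s) _ hd (x := φ (M.e s)) (by
      change ⁅φ (v : m), φ (M.e s)⁆ = _
      rw [← LieHom.map_lie, M.lie_e, hv, if_pos rfl, one_smul])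
    obtain ⟨d, hd⟩ := exists_sum_f_of_lie_eq G (fun k => ρ k = s) _ hd (x := φ (M.f s)) (by
      change ⁅φ (v : m), φ (M.f s)⁆ = _
      rw [← LieHom.map_lie, M.lie_f, hv, if_pos rfl, neg_smul, one_smul, map_neg])
    refine ⟨c, d, hc, hd, fun k hk => ?_⟩
    have hco : cartanIncl G M φ hle (M.coroot s) =
        ∑ i, if ρ i = s then (c i * d i) • G.coroot i else 0 := by
      refine Subtype.ext ?_
      rw [← lie_sum_e_sum_f, ← hc, ← hd, ← LieHom.map_lie, M.e_f, if_pos rfl]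
      rfl
    have h2 := hroot (M.coroot s) k
    rw [hco, hk, M.pairing, hBgcm.1, map_sum, Finset.sum_eq_single k] at h2
    · rw [if_pos hk, map_smul, G.pairing, hGCM.1, smul_eq_mul] at h2
      push_cast at h2
      linear_combination h2 / 2
    · intro i _ hik
      split_ifs with hi
      · rw [map_smul, G.pairing, hdisj k i hik.symm (hk.trans hi.symm)]
        simp
      · simp
    · simp
  choose c d hc hd hcd using hcoeff
  have hco : ∀ s, cartanIncl G M φ hle (M.coroot s) =
      ∑ k, if ρ k = s then G.coroot k else 0 := by
    intro s
    have h1 : cartanIncl G M φ hle (M.coroot s) =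
        ∑ k, if ρ k = s then (c s k * d s k) • G.coroot k else 0 := by
      refine Subtype.ext ?_
      rw [← lie_sum_e_sum_f, ← hc, ← hd, ← LieHom.map_lie, M.e_f, if_pos rfl]
      rfl
    rw [h1]
    refine Finset.sum_congr rfl fun k _ => ?_
    split_ifs with hk
    · rw [hcd s k hk, one_smul]
    · rfl
  refine ⟨fun k l hkl h => ⟨hdisj l k hkl.symm h.symm, hdisj k l hkl h⟩,
    fun x k l h => by rw [hroot, hroot, h],
    ⟨fun k => c (ρ k) k • G.e k, fun k => d (ρ k) k • G.f k,
      isChevalleyGens_smul G fun k => hcd (ρ k) k rfl, M.e, M.f, isChevalleyGens_self M,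
      fun s => ?_, fun s => ?_, fun s => ?_⟩, ?_⟩
  · rw [finsum_mem_setOf_eq]
    refine (congrArg Subtype.val (hco s)).trans ?_
    rw [AddSubmonoidClass.coe_finsetSum]
    refine Finset.sum_congr rfl fun k _ => ?_
    split_ifs <;> rfl
  · rw [finsum_mem_setOf_eq, hc]
    refine Finset.sum_congr rfl fun k _ => ?_
    split_ifs with hk
    · rw [hk]
    · rfl
  · rw [finsum_mem_setOf_eq, hd]
    refine Finset.sum_congr rfl fun k _ => ?_
    split_ifs with hk
    · rw [hk]
    · rfl
  · rintro _ t i rfl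
    rw [finsum_mem_setOf_eq, ← M.pairing, ← hroot, hco, map_sum]
    refine Finset.sum_congr rfl fun k _ => ?_
    split_ifs
    · rw [G.pairing]
    · exact map_zero _

end Statement
end
end
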